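/- arXiv:1303.4897 — 2 statements merged into one kernel-verified Lean document; each statement's English description precedes it below -/
import Mathlib

section
/- For every integer k ≥ 1 there is a constant c_k = 2^{O(k)} (one may take c_k = 216·c·(k+1)·3^k for a universal constant c) such that for every undirected graph G of treewidth at most k and every instance of MEDP on G, the integrality gap of the multicommodity flow LP relaxation is at most c_k with congestion 1: given any fractional solution x of the LP of value val(x), there exists an integral routing, on edge-disjoint paths (congestion 1), of at least val(x)/c_k of the demand pairs. -/
open Finset

/-- Count of occurrences of `e` in a list (classical, no decidability assumptions). -/
noncomputable def ecount {α : Type} (l : List α) (e : α) : ℕ :=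
  letI := Classical.decEq α
  l.count e

/-- A fractional solution to the multicommodity-flow LP relaxation of MEDP on the
graph `G` (with unit edge capacities) for the demand pairs `(s d, t d)`, `d : Fin n`.
It consists of finitely many flow paths (walks), each joining the endpoints of its
demand, with nonnegative values, total value at most `1` per demand, and total value
at most `1` per edge. -/
structure FracSol {V : Type} (G : SimpleGraph V) {n : ℕ} (s t : Fin n → V) where
  m : ℕ
  dem : Fin m → Fin n
  fpath : ∀ i : Fin m, G.Walk (s (dem i)) (t (dem i))
  xval : Fin m → ℝ
  nonneg : ∀ i, 0 ≤ xval i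
  perDemand : ∀ d : Fin n,
    (∑ i : Fin m, if dem i = d then xval i else 0) ≤ 1
  capacity : ∀ e : Sym2 V,
    (∑ i : Fin m, (ecount (fpath i).edges e : ℝ) * xval i) ≤ 1

namespace FracSol

variable {V : Type} {G : SimpleGraph V} {n : ℕ} {s t : Fin n → V}

/-- The value `val(x) = ∑_P x_P` of a fractional solution. -/
noncomputable def value (x : FracSol G s t) : ℝ := ∑ i, x.xval i

/-- The amount of flow `z_d` routed for demand `d`. -/
noncomputable def demVal (x : FracSol G s t) (d : Fin n) : ℝ :=
  ∑ i, if x.dem i = d then x.xval i else 0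

/-- The marginal value `x(v)` of a vertex `v`: total flow of demands having `v` as an
endpoint. -/
noncomputable def vertexMarg (x : FracSol G s t) (v : V) : ℝ :=
  letI := Classical.decEq V
  ∑ d : Fin n, if s d = v ∨ t d = v then x.demVal d else 0

end FracSol

/-- There is an integral routing, with congestion at most `c`, of at least `N` of the
demand pairs `(s d, t d)`: a subset `I` of at least `N` demands and for each a connecting
path, such that every edge lies on at most `c` of the paths (counted with multiplicity). -/
def HasIntegralRouting {V : Type} (G : SimpleGraph V) {n : ℕ}
    (s t : Fin n → V) (c : ℕ) (N : ℝ) : Prop :=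
  ∃ (I : Finset (Fin n)) (Q : ∀ d ∈ I, G.Walk (s d) (t d)),
    N ≤ (I.card : ℝ) ∧
    ∀ e : Sym2 V, (∑ d ∈ I.attach, ecount (Q d.1 d.2).edges e) ≤ c

/-- The demand pairs form a matching on the terminals: all `2n` endpoints are distinct. -/
def IsMatchingInstance {V : Type} {n : ℕ} (s t : Fin n → V) : Prop :=
  Function.Injective (fun p : Fin n × Bool => if p.2 then s p.1 else t p.1)

/-- The set of terminals of a demand family. -/
def terminalSet {V : Type} [DecidableEq V] {n : ℕ} (s t : Fin n → V) : Finset V :=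
  Finset.univ.image s ∪ Finset.univ.image t

/-- A tree decomposition of the graph `G`: a tree of bags covering all vertices and
edges, such that the bags containing any fixed vertex form a subtree. -/
structure TreeDecomp {V : Type} (G : SimpleGraph V) where
  B : Type
  T : SimpleGraph B
  isTree : T.IsTree
  bag : B → Finset V
  cover_vertex : ∀ v : V, ∃ b, v ∈ bag b
  cover_edge : ∀ ⦃u v : V⦄, G.Adj u v → ∃ b, u ∈ bag b ∧ v ∈ bag b
  coherent : ∀ (v : V) (b₁ b₂ : B), v ∈ bag b₁ → v ∈ bag b₂ →
    ∀ q : T.Walk b₁ b₂, q.IsPath → ∀ b ∈ q.support, v ∈ bag b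

/-- `G` has treewidth at most `k`: it admits a tree decomposition with all bags of
size at most `k + 1`. -/
def treewidthLE {V : Type} (G : SimpleGraph V) (k : ℕ) : Prop :=
  ∃ td : TreeDecomp G, ∀ b, (td.bag b).card ≤ k + 1

namespace SimpleGraph

variable {V : Type}

open Classical in
/-- The number of pairs `(a, b) ∈ A × B` that are adjacent in `G`. -/
noncomputable def cutCard (G : SimpleGraph V) (A B : Finset V) : ℤ :=
  ∑ a ∈ A, ∑ b ∈ B, if G.Adj a b then 1 else 0

/-- The graph on all of `V` whose edges are the edges of `G` inside `S`. -/
def within (G : SimpleGraph V) (S : Finset V) : SimpleGraph V where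
  Adj u v := G.Adj u v ∧ u ∈ S ∧ v ∈ S
  symm := ⟨fun _ _ h => ⟨h.1.symm, h.2.2, h.2.1⟩⟩
  loopless := ⟨fun _ h => h.1.ne rfl⟩

theorem cutCard_nonneg (G : SimpleGraph V) (A B : Finset V) : 0 ≤ G.cutCard A B :=
  Finset.sum_nonneg fun _ _ => Finset.sum_nonneg fun _ _ => by split_ifs <;> norm_num

theorem cutCard_comm (G : SimpleGraph V) (A B : Finset V) :
    G.cutCard A B = G.cutCard B A := by
  unfold cutCard
  rw [Finset.sum_comm]
  exact Finset.sum_congr rfl fun a _ => Finset.sum_congr rfl fun b _ =>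
    by classical exact if_congr (G.adj_comm _ _) rfl rfl

theorem cutCard_eq_zero {G : SimpleGraph V} {A B : Finset V}
    (h : ∀ a ∈ A, ∀ b ∈ B, ¬ G.Adj a b) : G.cutCard A B = 0 :=
  Finset.sum_eq_zero fun a ha => Finset.sum_eq_zero fun b hb => if_neg (h a ha b hb)

theorem one_le_cutCard {G : SimpleGraph V} {A B : Finset V} {a b : V}
    (ha : a ∈ A) (hb : b ∈ B) (h : G.Adj a b) : 1 ≤ G.cutCard A B := by
  classical
  unfold cutCard
  have h1 : (1 : ℤ) ≤ ∑ b ∈ B, if G.Adj a b then 1 else 0 := by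
    have := Finset.single_le_sum (f := fun b => if G.Adj a b then (1 : ℤ) else 0)
      (fun i _ => by split_ifs <;> norm_num) hb
    simpa [h] using this
  refine h1.trans (Finset.single_le_sum (f := fun a => ∑ b ∈ B, if G.Adj a b then (1 : ℤ) else 0)
    (fun i _ => Finset.sum_nonneg fun _ _ => by split_ifs <;> norm_num) ha)

@[simp] theorem cutCard_empty_right (G : SimpleGraph V) (A : Finset V) :
    G.cutCard A ∅ = 0 := by simp [cutCard]

@[simp] theorem cutCard_empty_left (G : SimpleGraph V) (A : Finset V) :
    G.cutCard ∅ A = 0 := by simp [cutCard]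

variable [DecidableEq V]

theorem cutCard_right_split (G : SimpleGraph V) (A : Finset V) {B C : Finset V} (h : B ⊆ C) :
    G.cutCard A C = G.cutCard A B + G.cutCard A (C \ B) := by
  unfold cutCard
  rw [← Finset.sum_add_distrib]
  refine Finset.sum_congr rfl fun a _ => ?_
  rw [add_comm, Finset.sum_sdiff h]

theorem cutCard_left_split (G : SimpleGraph V) (A : Finset V) {B C : Finset V} (h : B ⊆ C) :
    G.cutCard C A = G.cutCard B A + G.cutCard (C \ B) A := by
  rw [cutCard_comm, cutCard_right_split G A h, cutCard_comm, G.cutCard_comm A]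

theorem cutCard_union_left (G : SimpleGraph V) {A B : Finset V} (C : Finset V)
    (h : Disjoint A B) : G.cutCard (A ∪ B) C = G.cutCard A C + G.cutCard B C :=
  Finset.sum_union h

theorem cutCard_union_right (G : SimpleGraph V) {A B : Finset V} (C : Finset V)
    (h : Disjoint A B) : G.cutCard C (A ∪ B) = G.cutCard C A + G.cutCard C B := by
  rw [cutCard_comm, cutCard_union_left G C h, G.cutCard_comm C, G.cutCard_comm C]

theorem cutCard_mono_right (G : SimpleGraph V) (A : Finset V) {B C : Finset V} (h : B ⊆ C) :
    G.cutCard A B ≤ G.cutCard A C := by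
  rw [cutCard_right_split G A h]
  linarith [G.cutCard_nonneg A (C \ B)]

theorem cutCard_uncross (G : SimpleGraph V) {A B S : Finset V} (hA : A ⊆ S) (hB : B ⊆ S) :
    G.cutCard A (S \ A) + G.cutCard B (S \ B) =
      G.cutCard (A ∩ B) (S \ (A ∩ B)) + G.cutCard (A ∪ B) (S \ (A ∪ B)) +
        2 * G.cutCard (A \ B) (B \ A) := by
  have key : ∀ P Q R O : Finset V, Disjoint P Q → Disjoint P R → Disjoint P O →
      Disjoint Q R → Disjoint Q O → Disjoint R O →
      G.cutCard (P ∪ Q) (R ∪ O) + G.cutCard (P ∪ R) (Q ∪ O) =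
        G.cutCard P (Q ∪ (R ∪ O)) + G.cutCard (P ∪ (Q ∪ R)) O + 2 * G.cutCard Q R := by
    intro P Q R O h1 h2 h3 h4 h5 h6
    rw [cutCard_union_left _ _ h1, cutCard_union_left _ _ h2,
      cutCard_union_left _ _ (Finset.disjoint_union_right.2 ⟨h1, h2⟩),
      cutCard_union_left _ _ h4]
    rw [cutCard_union_right _ _ h6, cutCard_union_right _ _ h6, cutCard_union_right _ _ h5,
      cutCard_union_right _ _ h5, cutCard_union_right _ _
        (Finset.disjoint_union_right.2 ⟨h4, h5⟩), cutCard_union_right _ _ h6,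
      G.cutCard_comm R Q]
    ring
  have := key (A ∩ B) (A \ B) (B \ A) (S \ (A ∪ B))
    (by rw [Finset.disjoint_left]; grind) (by rw [Finset.disjoint_left]; grind)
    (by rw [Finset.disjoint_left]; grind) (by rw [Finset.disjoint_left]; grind)
    (by rw [Finset.disjoint_left]; grind) (by rw [Finset.disjoint_left]; grind)
  have e1 : A ∩ B ∪ A \ B = A := by
    ext v; simp only [mem_union, mem_sdiff, mem_inter]; tauto
  have e2 : A ∩ B ∪ B \ A = B := by
    ext v; simp only [mem_union, mem_sdiff, mem_inter]; tauto
  have e3 : B \ A ∪ S \ (A ∪ B) = S \ A := by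
    ext v; have := @hA v; have := @hB v
    simp only [mem_union, mem_sdiff]; tauto
  have e4 : A \ B ∪ S \ (A ∪ B) = S \ B := by
    ext v; have := @hA v; have := @hB v
    simp only [mem_union, mem_sdiff]; tauto
  have e5 : A \ B ∪ S \ A = S \ (A ∩ B) := by
    ext v; have := @hA v; have := @hB v
    simp only [mem_union, mem_sdiff, mem_inter]; tauto
  have e6 : A ∩ B ∪ (A \ B ∪ B \ A) = A ∪ B := by
    ext v; simp only [mem_union, mem_sdiff, mem_inter]; tauto
  rwa [e1, e2, e3, e4, e5, e6] at this

theorem cutCard_within (G : SimpleGraph V) [Fintype V] (S W : Finset V) :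
    (G.within S).cutCard W Wᶜ = G.cutCard (W ∩ S) (S \ (W ∩ S)) := by
  classical
  have h1 : (G.within S).cutCard (W \ (W ∩ S)) Wᶜ = 0 :=
    cutCard_eq_zero fun a ha b _ h => by have := h.2.1; grind
  have h2 : (G.within S).cutCard (W ∩ S) (Wᶜ \ (S \ (W ∩ S))) = 0 :=
    cutCard_eq_zero fun a _ b hb h => by
      have := h.2.2
      simp only [Finset.mem_sdiff, Finset.mem_compl, Finset.mem_inter] at hb
      tauto
  have h3 : S \ (W ∩ S) ⊆ Wᶜ := by
    intro v
    simp only [Finset.mem_sdiff, Finset.mem_compl, Finset.mem_inter]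
    tauto
  rw [cutCard_left_split _ _ (Finset.inter_subset_left : W ∩ S ⊆ W), h1,
    cutCard_right_split _ _ h3, h2, add_zero, add_zero]
  refine Finset.sum_congr rfl fun a ha => Finset.sum_congr rfl fun b hb => ?_
  have : (G.within S).Adj a b ↔ G.Adj a b := by
    simp only [within]; grind
  simp only [this]

end SimpleGraph

namespace SimpleGraph

variable {V : Type} [Fintype V] [DecidableEq V]

theorem cutCard_deleteEdges_ge (H : SimpleGraph V) (u v : V) {W : Finset V}
    (hu : u ∈ W) :
    H.cutCard W Wᶜ - 1 ≤ (H.deleteEdges {s(u, v)}).cutCard W Wᶜ := by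
  classical
  have h1 : H.cutCard W Wᶜ ≤ (H.deleteEdges {s(u, v)}).cutCard W Wᶜ +
      ∑ a ∈ W, ∑ b ∈ Wᶜ, if a = u ∧ b = v then (1 : ℤ) else 0 := by
    unfold cutCard
    simp only [← Finset.sum_add_distrib]
    refine Finset.sum_le_sum fun a ha => Finset.sum_le_sum fun b hb => ?_
    have hb' := Finset.mem_compl.1 hb
    simp only [deleteEdges_adj, Set.mem_singleton_iff, Sym2.eq_iff]
    split_ifs <;> grind
  have h2 : ∑ a ∈ W, ∑ b ∈ Wᶜ, (if a = u ∧ b = v then (1 : ℤ) else 0) ≤ 1 := by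
    calc _ ≤ ∑ a ∈ W, if a = u then (1 : ℤ) else 0 := by
          refine Finset.sum_le_sum fun a _ => ?_
          by_cases h : a = u
          · simp only [h, true_and, if_true, Finset.sum_ite_eq']
            split_ifs <;> norm_num
          · simp [h]
      _ ≤ 1 := by
          rw [Finset.sum_ite_eq']
          (split_ifs; norm_num)
  linarith

theorem cutCard_deleteEdges_eq (H : SimpleGraph V) {u v : V} {W : Finset V}
    (h : u ∈ W ↔ v ∈ W) :
    (H.deleteEdges {s(u, v)}).cutCard W Wᶜ = H.cutCard W Wᶜ := by
  classical
  refine Finset.sum_congr rfl fun a ha => Finset.sum_congr rfl fun b hb => ?_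
  have hb' := Finset.mem_compl.1 hb
  have : (H.deleteEdges {s(u, v)}).Adj a b ↔ H.Adj a b := by
    simp only [deleteEdges_adj, Set.mem_singleton_iff, Sym2.eq_iff]
    grind
  simp only [this]

/-- Edge version of Menger's theorem with a single sink `w`: if every vertex set avoiding `w` has
a boundary at least as large as the number of sources in it, then the sources can be connected to
`w` inside pairwise edge-disjoint subgraphs. -/
theorem exists_disjoint_connectors {ι : Type} [Fintype ι] (w : V) (H : SimpleGraph V) :
    ∀ a : ι → V,
      (∀ W : Finset V, w ∉ W → (∑ i, if a i ∈ W then (1 : ℤ) else 0) ≤ H.cutCard W Wᶜ) →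
      ∃ F : ι → SimpleGraph V, (∀ i, F i ≤ H) ∧ (Pairwise fun i j => Disjoint (F i) (F j)) ∧
        ∀ i, (F i).Reachable (a i) w := by
  classical
  induction H using WellFoundedLT.induction with
  | ind H ih =>
  intro a ha
  have hlt : ∀ {u v}, H.Adj u v → H.deleteEdges {s(u, v)} < H := fun {u v} huv =>
    lt_of_le_of_ne (deleteEdges_le _) fun h => by
      have h' := huv
      rw [← h, deleteEdges_adj] at h'
      exact h'.2 rfl
  by_cases hdel : ∃ u v, H.Adj u v ∧ ∀ W : Finset V, w ∉ W →
      (∑ i, if a i ∈ W then (1 : ℤ) else 0) ≤ (H.deleteEdges {s(u, v)}).cutCard W Wᶜ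
  · obtain ⟨u, v, huv, hc⟩ := hdel
    obtain ⟨F, hF1, hF2, hF3⟩ := ih _ (hlt huv) a hc
    exact ⟨F, fun i => (hF1 i).trans (deleteEdges_le _), hF2, hF3⟩
  by_cases hall : ∀ i, a i = w
  · exact ⟨fun _ => ⊥, fun _ => bot_le, fun _ _ _ => disjoint_bot_left,
      fun i => by rw [hall i]⟩
  push Not at hall
  obtain ⟨i₀, hi₀⟩ := hall
  set τ : Finset V → ℤ := fun W => ∑ i, if a i ∈ W then (1 : ℤ) else 0 with hτ
  have tight : ∀ u v, H.Adj u v → ∃ W : Finset V, w ∉ W ∧ H.cutCard W Wᶜ = τ W ∧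
      ¬ (u ∈ W ↔ v ∈ W) := by
    intro u v huv
    push Not at hdel
    obtain ⟨W, hw, hW⟩ := hdel u v huv
    have hW0 := ha W hw
    have hsep : ¬ (u ∈ W ↔ v ∈ W) := fun h => by
      rw [cutCard_deleteEdges_eq H h] at hW
      linarith
    refine ⟨W, hw, ?_, hsep⟩
    have : H.cutCard W Wᶜ - 1 ≤ (H.deleteEdges {s(u, v)}).cutCard W Wᶜ := by
      by_cases hu : u ∈ W
      · exact cutCard_deleteEdges_ge H u v hu
      · rw [Sym2.eq_swap]
        exact cutCard_deleteEdges_ge H v u (by tauto)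
    simp only [hτ]
    omega
  have hmod : ∀ A B, τ A + τ B = τ (A ∩ B) + τ (A ∪ B) := by
    intro A B
    simp only [hτ, ← Finset.sum_add_distrib]
    refine Finset.sum_congr rfl fun i _ => ?_
    by_cases h1 : a i ∈ A <;> by_cases h2 : a i ∈ B <;> simp [h1, h2]
  have hunc : ∀ A B : Finset V, H.cutCard A Aᶜ + H.cutCard B Bᶜ =
      H.cutCard (A ∩ B) (A ∩ B)ᶜ + H.cutCard (A ∪ B) (A ∪ B)ᶜ +
        2 * H.cutCard (A \ B) (B \ A) := by
    intro A B
    simp only [Finset.compl_eq_univ_sdiff]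
    exact H.cutCard_uncross (Finset.subset_univ _) (Finset.subset_univ _)
  have key : ∃ q W, H.Adj (a i₀) q ∧ w ∉ W ∧ H.cutCard W Wᶜ = τ W ∧ a i₀ ∈ W ∧ q ∉ W := by
    by_contra hno
    push Not at hno
    obtain ⟨Y, hY, hYmax⟩ := Finset.exists_max_image
      (Finset.univ.filter fun W : Finset V => w ∉ W ∧ H.cutCard W Wᶜ = τ W ∧ a i₀ ∉ W)
      Finset.card ⟨∅, by simp [hτ]⟩
    simp only [Finset.mem_filter, Finset.mem_univ, true_and] at hY hYmax
    obtain ⟨hwY, hYt, hpY⟩ := hY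
    have hnb : ∀ q, H.Adj (a i₀) q → q ∈ Y := by
      intro q hq
      obtain ⟨W, hw, hW, hsep⟩ := tight _ _ hq
      have hpW : a i₀ ∉ W := fun h => hsep ⟨fun _ => hno q W hq hw hW h, fun _ => h⟩
      have hqW : q ∈ W := by tauto
      have hwU : w ∉ Y ∪ W := by simp [hw, hwY]
      have h1 := ha (Y ∪ W) hwU
      have h2 := ha (Y ∩ W) (by simp [hw])
      have h3 := hunc Y W
      have h4 := hmod Y W
      have h5 := H.cutCard_nonneg (Y \ W) (W \ Y)
      have h6 := hYmax (Y ∪ W) ⟨hwU, by simp only [hτ] at *; omega, by simp [hpW, hpY]⟩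
      have := Finset.eq_of_subset_of_card_le Finset.subset_union_left h6
      rw [this]
      exact Finset.mem_union_right _ hqW
    have h1 := ha ({a i₀} ∪ Y) (by simp [hwY, Ne.symm hi₀])
    rw [cutCard_union_left _ _ (by simpa using hpY), cutCard_eq_zero (A := {a i₀})] at h1
    · have h2 : H.cutCard Y ({a i₀} ∪ Y)ᶜ ≤ H.cutCard Y Yᶜ :=
        cutCard_mono_right _ _ (Finset.compl_subset_compl.2 Finset.subset_union_right)
      have h3 : τ Y < ∑ i, if a i ∈ {a i₀} ∪ Y then (1 : ℤ) else 0 := by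
        refine Finset.sum_lt_sum (fun i _ => ?_) ⟨i₀, Finset.mem_univ _, ?_⟩
        · by_cases h : a i ∈ Y
          · simp [h]
          · simp only [h, if_false]
            split_ifs <;> norm_num
        · simp [hpY]
      omega
    · intro x hx b hb hadj
      rw [Finset.mem_singleton] at hx
      subst hx
      simp [hnb b hadj] at hb
  obtain ⟨q, W, hpq, hwW, hWt, hpW, hqW⟩ := key
  have hτ' : ∀ X : Finset V, (∑ i, if Function.update a i₀ q i ∈ X then (1 : ℤ) else 0) =
      τ X - (if a i₀ ∈ X then 1 else 0) + if q ∈ X then 1 else 0 := by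
    intro X
    simp only [hτ]
    rw [← Finset.add_sum_erase _ _ (Finset.mem_univ i₀),
      ← Finset.add_sum_erase _ (fun i => if a i ∈ X then (1 : ℤ) else 0) (Finset.mem_univ i₀)]
    have : ∑ i ∈ Finset.univ.erase i₀, (if Function.update a i₀ q i ∈ X then (1 : ℤ) else 0) =
        ∑ i ∈ Finset.univ.erase i₀, if a i ∈ X then (1 : ℤ) else 0 :=
      Finset.sum_congr rfl fun i hi => by
        rw [Function.update_of_ne (Finset.ne_of_mem_erase hi)]
    rw [this, Function.update_self]
    ring
  obtain ⟨F, hF1, hF2, hF3⟩ := ih _ (hlt hpq) (Function.update a i₀ q) (by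
    intro X hwX
    rw [hτ']
    have h0 := ha X hwX
    change τ X ≤ _ at h0
    by_cases h1 : a i₀ ∈ X <;> by_cases h2 : q ∈ X
    · rw [cutCard_deleteEdges_eq H (by tauto)]
      simp [h1, h2, h0]
    · have := cutCard_deleteEdges_ge H (a i₀) q h1
      simp only [h1, h2, if_true, if_false]
      omega
    · have h3 := cutCard_deleteEdges_ge H q (a i₀) h2
      rw [Sym2.eq_swap] at h3
      have h4 := ha (W ∪ X) (by simp [hwW, hwX])
      have h5 := ha (W ∩ X) (by simp [hwW])
      have h6 := hunc W X
      have h7 := hmod W X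
      have h8 : 1 ≤ H.cutCard (W \ X) (X \ W) :=
        one_le_cutCard (Finset.mem_sdiff.2 ⟨hpW, h1⟩) (Finset.mem_sdiff.2 ⟨h2, hqW⟩) hpq
      simp only [h1, h2, if_true, if_false]
      simp only [hτ] at *
      omega
    · rw [cutCard_deleteEdges_eq H (by tauto)]
      simp [h1, h2, h0])
  have hdis : ∀ i, Disjoint (F i) (edge (a i₀) q) := fun i =>
    ((disjoint_edge _).2 fun h => by simp [deleteEdges_adj] at h).mono_left (hF1 i)
  refine ⟨fun i => if i = i₀ then F i ⊔ edge (a i₀) q else F i, fun i => ?_, fun i j hij => ?_,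
    fun i => ?_⟩
  · dsimp only
    split_ifs
    · refine sup_le ((hF1 i).trans (deleteEdges_le _)) ?_
      rw [edge_le_iff]
      exact Or.inr hpq
    · exact (hF1 i).trans (deleteEdges_le _)
  · dsimp only
    split_ifs with h1 h2 h2
    · exact absurd (h1.trans h2.symm) hij
    · exact disjoint_sup_left.2 ⟨hF2 hij, (hdis j).symm⟩
    · exact disjoint_sup_right.2 ⟨hF2 hij, hdis i⟩
    · exact hF2 hij
  · have h := hF3 i
    dsimp only
    split_ifs with h1
    · subst h1
      rw [Function.update_self] at h
      refine Reachable.trans (Adj.reachable ?_) (h.mono le_sup_left)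
      exact Or.inr ((edge_adj _ _ _ _).2 ⟨Or.inl ⟨rfl, rfl⟩, hpq.ne⟩)
    · rwa [Function.update_of_ne h1] at h

end SimpleGraph

/-- The total weight `q` of the demands `d ∈ D`, counted once for every endpoint equal to `v`. -/
def endLoad {V ι R : Type} [DecidableEq V] [Semiring R] (s t : ι → V) (q : ι → R) (D : Finset ι)
    (v : V) : R :=
  ∑ d ∈ D, ((if s d = v then q d else 0) + if t d = v then q d else 0)

/-- The demands in `D` can be routed edge-disjointly inside `G[S]`. -/
def RoutableIn {V ι : Type} (G : SimpleGraph V) (s t : ι → V) (S : Finset V) (D : Finset ι) :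
    Prop :=
  ∃ F : ι → SimpleGraph V, (∀ d ∈ D, F d ≤ G.within S) ∧
    (∀ d ∈ D, ∀ d' ∈ D, d ≠ d' → Disjoint (F d) (F d')) ∧
    ∀ d ∈ D, (F d).Reachable (s d) (t d)

section

variable {V ι : Type} [DecidableEq V]

theorem sum_endLoad {R : Type} [Semiring R] (s t : ι → V) (q : ι → R) (D : Finset ι)
    (W : Finset V) : ∑ v ∈ W, endLoad s t q D v =
      ∑ d ∈ D, ((if s d ∈ W then q d else 0) + if t d ∈ W then q d else 0) := by
  unfold endLoad
  rw [Finset.sum_comm]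
  refine Finset.sum_congr rfl fun d _ => ?_
  rw [Finset.sum_add_distrib]
  rw [Finset.sum_ite_eq, Finset.sum_ite_eq]

theorem endLoad_nonneg {R : Type} [Semiring R] [LinearOrder R] [IsStrictOrderedRing R]
    {s t : ι → V} {q : ι → R} {D : Finset ι} (h : ∀ d ∈ D, 0 ≤ q d) (v : V) :
    0 ≤ endLoad s t q D v :=
  Finset.sum_nonneg fun d hd => by
    have := h d hd
    split_ifs <;> simp [this]

theorem endLoad_mono {s t : ι → V} {q : ι → ℝ} {D D' : Finset ι} (h : ∀ d ∈ D', 0 ≤ q d)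
    (hD : D ⊆ D') (v : V) : endLoad s t q D v ≤ endLoad s t q D' v :=
  Finset.sum_le_sum_of_subset_of_nonneg hD fun d hd _ => by
    have := h d hd
    split_ifs <;> simp [this]

theorem le_sum_endLoad {s t : ι → V} {q : ι → ℝ} {D : Finset ι} (h : ∀ d ∈ D, 0 ≤ q d)
    {d : ι} (hd : d ∈ D) {W : Finset V} (hW : s d ∈ W ∨ t d ∈ W) :
    q d ≤ ∑ v ∈ W, endLoad s t q D v := by
  rw [sum_endLoad]
  refine le_trans ?_ (Finset.single_le_sum (f := fun d =>
    ((if s d ∈ W then q d else 0) + if t d ∈ W then q d else 0)) (fun i hi => ?_) hd)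
  · have := h d hd
    rcases hW with h1 | h1 <;> simp only [h1, if_true] <;> split_ifs <;> linarith
  · have := h i hi
    split_ifs <;> linarith

namespace SimpleGraph

omit [DecidableEq V] in
theorem within_mono (G : SimpleGraph V) {S S' : Finset V} (h : S ⊆ S') :
    G.within S ≤ G.within S' :=
  fun _ _ hh => ⟨hh.1, h hh.2.1, h hh.2.2⟩

omit [DecidableEq V] in
theorem disjoint_within (G : SimpleGraph V) {S S' : Finset V} (h : Disjoint S S') :
    Disjoint (G.within S) (G.within S') :=
  disjoint_left.2 fun _ _ h1 h2 => Finset.disjoint_left.1 h h1.2.1 h2.2.1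

end SimpleGraph

omit [DecidableEq V] in
theorem RoutableIn.union [DecidableEq ι] {G : SimpleGraph V} {s t : ι → V} {S S' A : Finset V}
    {D D' : Finset ι}
    (h : RoutableIn G s t S D) (h' : RoutableIn G s t S' D') (hS : S ⊆ A) (hS' : S' ⊆ A)
    (hd : Disjoint S S') : RoutableIn G s t A (D ∪ D') := by
  obtain ⟨F, h1, h2, h3⟩ := h
  obtain ⟨F', h1', h2', h3'⟩ := h'
  have hm : ∀ d, d ∈ D ∪ D' → d ∉ D → d ∈ D' := fun d hd hn =>
    (Finset.mem_union.1 hd).resolve_left hn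
  have hw := G.disjoint_within hd
  refine ⟨fun d => if d ∈ D then F d else F' d, fun d hd => ?_, fun d hd d' hd' hne => ?_,
    fun d hd => ?_⟩
  · dsimp only
    split_ifs with hh
    · exact (h1 d hh).trans (G.within_mono hS)
    · exact (h1' d (hm d hd hh)).trans (G.within_mono hS')
  · dsimp only
    split_ifs with hh hh' hh'
    · exact h2 _ hh _ hh' hne
    · exact hw.mono (h1 _ hh) (h1' _ (hm _ hd' hh'))
    · exact (hw.mono (h1 _ hh') (h1' _ (hm _ hd hh))).symm
    · exact h2' _ (hm _ hd hh) _ (hm _ hd' hh') hne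
  · dsimp only
    split_ifs with hh
    · exact h3 d hh
    · exact h3' d (hm d hd hh)

namespace SimpleGraph

/-- A set `W` whose boundary has at most one edge connects every demand of positive weight with
both ends in `W`, if boundaries dominate the end loads. -/
theorem reachable_of_cutCard_le_one {G : SimpleGraph V} {s t : ι → V} {q : ι → ℝ}
    {S W : Finset V} {w : V} {Dm : Finset ι} (hq : ∀ d ∈ Dm, 0 < q d)
    (hcut : ∀ W ⊆ S, w ∉ W → ∑ v ∈ W, endLoad s t q Dm v ≤ G.cutCard W (S \ W))
    (hWS : W ⊆ S) (hw : w ∉ W) (hW : G.cutCard W (S \ W) ≤ 1) {d : ι} (hd : d ∈ Dm)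
    (hs : s d ∈ W) (ht : t d ∈ W) : (G.within W).Reachable (s d) (t d) := by
  classical
  by_contra hno
  set C := W.filter fun v => (G.within W).Reachable (s d) v with hC
  have hCW : C ⊆ W := Finset.filter_subset _ _
  have hsC : s d ∈ C := Finset.mem_filter.2 ⟨hs, Reachable.refl _⟩
  have htC : t d ∈ W \ C := Finset.mem_sdiff.2 ⟨ht, fun h => hno (Finset.mem_filter.1 h).2⟩
  have h0 : G.cutCard C (W \ C) = 0 := cutCard_eq_zero fun a ha b hb hab => by
    rw [Finset.mem_sdiff] at hb
    refine hb.2 (Finset.mem_filter.2 ⟨hb.1, ?_⟩)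
    exact (Finset.mem_filter.1 ha).2.trans (Adj.reachable ⟨hab, hCW ha, hb.1⟩)
  have pos : ∀ X ⊆ W, s d ∈ X ∨ t d ∈ X → 1 ≤ G.cutCard X (S \ X) := by
    intro X hX hX'
    have h1 := hcut X (hX.trans hWS) fun h => hw (hX h)
    have h2 := le_sum_endLoad (s := s) (t := t) (fun d hd => (hq d hd).le) hd hX'
    have h3 := hq d hd
    have : (0 : ℝ) < G.cutCard X (S \ X) := by linarith
    exact_mod_cast this
  have h1 := pos C hCW (Or.inl hsC)
  have h2 := pos (W \ C) Finset.sdiff_subset (Or.inr htC)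
  have e1 := G.cutCard_left_split (S \ W) hCW
  have e2 := G.cutCard_right_split C (show S \ W ⊆ S \ C from Finset.sdiff_subset_sdiff le_rfl hCW)
  have e3 : (S \ C) \ (S \ W) = W \ C := by
    ext v; have := @hWS v; simp only [mem_sdiff]; tauto
  have e4 := G.cutCard_right_split (W \ C)
    (show S \ W ⊆ S \ (W \ C) from Finset.sdiff_subset_sdiff le_rfl Finset.sdiff_subset)
  have e5 : (S \ (W \ C)) \ (S \ W) = C := by
    ext v; have := @hWS v; have := @hCW v; simp only [mem_sdiff]; tauto
  rw [e3] at e2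
  rw [e5, G.cutCard_comm _ C] at e4
  omega

end SimpleGraph

/-- If, for a subset `D` of the demands, boundaries dominate the number of ends, then `D` can be
routed through `w`. -/
theorem routableIn_of_cut [Fintype V] {G : SimpleGraph V} {s t : ι → V} {S : Finset V} {w : V}
    {D : Finset ι} (hS : ∀ d ∈ D, s d ∈ S ∧ t d ∈ S)
    (hcut : ∀ W ⊆ S, w ∉ W → ∑ v ∈ W, endLoad s t (fun _ => (1 : ℤ)) D v ≤
      G.cutCard W (S \ W)) : RoutableIn G s t S D := by
  classical
  obtain ⟨F, h1, h2, h3⟩ := SimpleGraph.exists_disjoint_connectors (ι := D × Bool) w (G.within S)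
    (fun p => if p.2 then s p.1 else t p.1) (by
      intro W hw
      rw [SimpleGraph.cutCard_within]
      refine le_trans (le_of_eq ?_)
        (hcut (W ∩ S) Finset.inter_subset_right (by simp [hw]))
      rw [sum_endLoad, Fintype.sum_prod_type, ← Finset.sum_coe_sort D]
      refine Finset.sum_congr rfl fun d _ => ?_
      have := hS d d.2
      rw [Fintype.sum_bool]
      simp [this.1, this.2])
  refine ⟨fun d => if h : d ∈ D then F (⟨d, h⟩, true) ⊔ F (⟨d, h⟩, false) else ⊥,
    fun d hd => ?_, fun d hd d' hd' hne => ?_, fun d hd => ?_⟩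
  · simp only [hd, dif_pos]
    exact sup_le (h1 _) (h1 _)
  · simp only [hd, hd', dif_pos]
    have : ∀ b b', Disjoint (F (⟨d, hd⟩, b)) (F (⟨d', hd'⟩, b')) := fun b b' =>
      h2 (by simp [hne])
    simp [disjoint_sup_left, disjoint_sup_right, this]
  · simp only [hd, dif_pos]
    have e1 := h3 (⟨d, hd⟩, true)
    have e2 := h3 (⟨d, hd⟩, false)
    simp only [if_true] at e1
    simp only [Bool.false_eq_true, if_false] at e2
    exact (e1.mono le_sup_left).trans (e2.mono le_sup_right).symm

theorem sum_endLoad_eq_two_mul_card {s t : ι → V} {D : Finset ι} {S : Finset V}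
    (hS : ∀ d ∈ D, s d ∈ S ∧ t d ∈ S) :
    ∑ v ∈ S, endLoad s t (fun _ => (1 : ℤ)) D v = 2 * D.card := by
  rw [sum_endLoad, Finset.sum_congr rfl (g := fun _ => (2 : ℤ)) fun d hd => by
    simp [hS d hd]]
  simp [mul_comm]

/-- Routing through `w` when no demand is enclosed by a set with at most one boundary edge. -/
theorem hub_routing_of_two_le [Fintype V] [DecidableEq ι] {G : SimpleGraph V} {s t : ι → V}
    {q : ι → ℝ} {S : Finset V} {w : V} {Dm : Finset ι}
    (hS : ∀ d ∈ Dm, s d ∈ S ∧ t d ∈ S) (hq0 : ∀ d ∈ Dm, 0 < q d) (hq1 : ∀ d ∈ Dm, q d ≤ 1)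
    (hcut : ∀ W ⊆ S, w ∉ W → ∑ v ∈ W, endLoad s t q Dm v ≤ G.cutCard W (S \ W))
    (htwo : ∀ W ⊆ S, w ∉ W → ∀ d ∈ Dm, s d ∈ W → t d ∈ W → 2 ≤ G.cutCard W (S \ W)) :
    ∃ D ⊆ Dm, RoutableIn G s t S D ∧ ∑ d ∈ Dm, q d ≤ 6 * D.card := by
  classical
  set τ : Finset ι → Finset V → ℤ := fun D W => ∑ v ∈ W, endLoad s t (fun _ => (1 : ℤ)) D v
    with hτ
  obtain ⟨D, hD⟩ := Finset.exists_maximal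
    (s := Dm.powerset.filter fun D => ∀ W ⊆ S, w ∉ W → τ D W ≤ G.cutCard W (S \ W))
    ⟨∅, by
      rw [Finset.mem_filter]
      refine ⟨by simp, fun W _ _ => ?_⟩
      simp only [hτ, sum_endLoad, Finset.sum_empty]
      exact G.cutCard_nonneg _ _⟩
  obtain ⟨hDmem, hDmax⟩ := hD
  rw [Finset.mem_filter, Finset.mem_powerset] at hDmem
  obtain ⟨hDD, hDc⟩ := hDmem
  have hSD : ∀ d ∈ D, s d ∈ S ∧ t d ∈ S := fun d hd => hS d (hDD hd)
  refine ⟨D, hDD, routableIn_of_cut hSD hDc, ?_⟩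
  have hτ0 : ∀ W, 0 ≤ τ D W := fun W =>
    Finset.sum_nonneg fun v _ => endLoad_nonneg (fun _ _ => zero_le_one) v
  have hmod : ∀ A B, τ D A + τ D B = τ D (A ∩ B) + τ D (A ∪ B) := fun A B => by
    rw [add_comm (τ D (A ∩ B))]
    exact (Finset.sum_union_inter).symm
  have hunc : ∀ A ⊆ S, ∀ B ⊆ S, _ := fun A hA B hB => G.cutCard_uncross hA hB
  obtain ⟨T, hT, hTmax⟩ := Finset.exists_max_image
    (S.powerset.filter fun W => w ∉ W ∧ G.cutCard W (S \ W) = τ D W) Finset.card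
    ⟨∅, by simp [hτ]⟩
  simp only [Finset.mem_filter, Finset.mem_powerset] at hT hTmax
  obtain ⟨hTS, hwT, hTt⟩ := hT
  have htight : ∀ W ⊆ S, w ∉ W → G.cutCard W (S \ W) ≤ τ D W → W ⊆ T := by
    intro W hWS hwW hWt
    have hwU : w ∉ T ∪ W := by simp [hwT, hwW]
    have hUS := Finset.union_subset hTS hWS
    have h1 := hDc _ hUS hwU
    have h2 := hDc (T ∩ W) (Finset.inter_subset_left.trans hTS) (by simp [hwT])
    have h3 := hunc T hTS W hWS
    have h4 := hmod T W
    have h5 := G.cutCard_nonneg (T \ W) (W \ T)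
    have h6 := hTmax (T ∪ W) ⟨hUS, hwU, by omega⟩
    rw [Finset.eq_of_subset_of_card_le Finset.subset_union_left h6]
    exact Finset.subset_union_right
  set 𝓕 : Finset (Finset V) :=
    S.powerset.filter fun U => T ⊆ U ∧ w ∉ U ∧ G.cutCard U (S \ U) ≤ τ D U + 1 with h𝓕
  have mem𝓕 : ∀ U, U ∈ 𝓕 ↔ U ⊆ S ∧ T ⊆ U ∧ w ∉ U ∧ G.cutCard U (S \ U) ≤ τ D U + 1 := by
    simp [h𝓕]
  -- every unrouted demand has an end in `T` or is enclosed by a maximal member of `𝓕`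
  have hcover : ∀ d ∈ Dm, d ∉ D → (s d ∈ T ∨ t d ∈ T) ∨
      ∃ U, Maximal (· ∈ 𝓕) U ∧ s d ∈ U \ T ∧ t d ∈ U \ T := by
    intro d hd hdD
    by_contra! hno
    obtain ⟨⟨hsT, htT⟩, hno⟩ := hno
    have hnot : insert d D ∉ Dm.powerset.filter
        fun D => ∀ W ⊆ S, w ∉ W → τ D W ≤ G.cutCard W (S \ W) := fun h =>
      hdD (hDmax h (Finset.subset_insert d D) (Finset.mem_insert_self d D))
    rw [Finset.mem_filter, Finset.mem_powerset] at hnot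
    push Not at hnot
    obtain ⟨W, hWS, hwW, hW⟩ := hnot (Finset.insert_subset hd hDD)
    have hins : τ (insert d D) W = ((if s d ∈ W then 1 else 0) + if t d ∈ W then 1 else 0) +
        τ D W := by
      simp only [hτ, sum_endLoad]
      rw [Finset.sum_insert hdD]
    rw [hins] at hW
    have hg := hDc W hWS hwW
    have hst : s d ∈ W ∧ t d ∈ W := by
      by_contra hh
      have : W ⊆ T := htight W hWS hwW (by
        by_cases h1 : s d ∈ W <;> by_cases h2 : t d ∈ W <;> simp [h1, h2] at hW hh <;> omega)
      have h1 : s d ∉ W := fun h => hsT (this h)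
      have h2 : t d ∉ W := fun h => htT (this h)
      simp [h1, h2] at hW
      omega
    simp only [hst.1, hst.2, if_true] at hW
    have hU : T ∪ W ∈ 𝓕 := by
      refine (mem𝓕 _).2 ⟨Finset.union_subset hTS hWS, Finset.subset_union_left,
        by simp [hwT, hwW], ?_⟩
      have h2 := hDc (T ∩ W) (Finset.inter_subset_left.trans hTS) (by simp [hwT])
      have h3 := hunc T hTS W hWS
      have h4 := hmod T W
      have h5 := G.cutCard_nonneg (T \ W) (W \ T)
      omega
    obtain ⟨U, hle, hUmax⟩ := Finset.exists_le_maximal _ hU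
    have hWU : W ⊆ U := Finset.subset_union_right.trans hle
    exact hno U hUmax (Finset.mem_sdiff.2 ⟨hWU hst.1, hsT⟩)
      (Finset.mem_sdiff.2 ⟨hWU hst.2, htT⟩)
  set 𝓜 : Finset (Finset V) := 𝓕.filter fun U => Maximal (· ∈ 𝓕) U ∧
    ∃ d ∈ Dm, s d ∈ U \ T ∧ t d ∈ U \ T with h𝓜
  have hdisj : (𝓜 : Set (Finset V)).PairwiseDisjoint fun U => U \ T := by
    intro A hA B hB hAB
    have hA' := (Finset.mem_filter.1 (Finset.mem_coe.1 hA)).2.1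
    have hB' := (Finset.mem_filter.1 (Finset.mem_coe.1 hB)).2.1
    obtain ⟨hAS, hTA, hwA, hAg⟩ := (mem𝓕 A).1 hA'.1
    obtain ⟨hBS, hTB, hwB, hBg⟩ := (mem𝓕 B).1 hB'.1
    have hwU : w ∉ A ∪ B := by simp [hwA, hwB]
    have hUS := Finset.union_subset hAS hBS
    have h3 := hunc A hAS B hBS
    have h4 := hmod A B
    have h5 := G.cutCard_nonneg (A \ B) (B \ A)
    have h6 : τ D (A ∪ B) + 2 ≤ G.cutCard (A ∪ B) (S \ (A ∪ B)) := by
      by_contra hlt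
      have hmem : A ∪ B ∈ 𝓕 := (mem𝓕 _).2
        ⟨hUS, hTA.trans Finset.subset_union_left, hwU, by omega⟩
      have h7 : B ⊆ A := Finset.subset_union_right.trans
        (hA'.2 hmem (Finset.subset_union_left : A ⊆ A ∪ B))
      have h8 : A ⊆ B := Finset.subset_union_left.trans
        (hB'.2 hmem (Finset.subset_union_right : B ⊆ A ∪ B))
      exact hAB (h8.antisymm h7)
    have h7 := htight (A ∩ B) (Finset.inter_subset_left.trans hAS) (by simp [hwA]) (by omega)
    rw [Function.onFun, Finset.disjoint_left]
    intro v hv hv'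
    rw [Finset.mem_sdiff] at hv hv'
    exact hv.2 (h7 (Finset.mem_inter.2 ⟨hv.1, hv'.1⟩))
  have hZS : 𝓜.biUnion (fun U => U \ T) ⊆ S \ T := by
    rw [Finset.biUnion_subset]
    intro U hU
    exact Finset.sdiff_subset_sdiff ((mem𝓕 U).1 (Finset.mem_filter.1 hU).1).1 le_rfl
  have hZcut : ∀ U ∈ 𝓜, G.cutCard (U \ T) (S \ (U \ T)) ≤
      3 * (G.cutCard T (U \ T) + τ D (U \ T)) := by
    intro U hU
    obtain ⟨hU𝓕, -, d, hd, hsd, htd⟩ := Finset.mem_filter.1 hU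
    obtain ⟨hUS, hTU, hwU, hUg⟩ := (mem𝓕 U).1 hU𝓕
    have h2 := htwo (U \ T) (Finset.sdiff_subset.trans hUS) (by simp [hwU]) d hd hsd htd
    have h3 := G.cutCard_left_split (S \ U) hTU
    have h4 := G.cutCard_right_split T
      (show U \ T ⊆ S \ T from Finset.sdiff_subset_sdiff hUS le_rfl)
    have e4 : (S \ T) \ (U \ T) = S \ U := by
      ext v; have := @hTU v; simp only [mem_sdiff]; tauto
    have h5 := G.cutCard_right_split (U \ T)
      (show T ⊆ S \ (U \ T) from fun v hv => by simp [hTS hv, hv])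
    have e5 : (S \ (U \ T)) \ T = S \ U := by
      ext v; have := @hTU v; simp only [mem_sdiff]; tauto
    rw [e4] at h4
    rw [e5, G.cutCard_comm _ T] at h5
    have h6 : τ D U = τ D (U \ T) + τ D T := (Finset.sum_sdiff hTU).symm
    have h7 := hτ0 (U \ T)
    have h8 := G.cutCard_nonneg T (U \ T)
    omega
  have htot : ∑ U ∈ 𝓜, G.cutCard (U \ T) (S \ (U \ T)) ≤ 6 * D.card := by
    have h1 : ∑ U ∈ 𝓜, G.cutCard T (U \ T) ≤ G.cutCard T (S \ T) := by
      refine le_trans (le_of_eq ?_) (G.cutCard_mono_right T hZS)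
      rw [G.cutCard_comm]
      unfold SimpleGraph.cutCard
      rw [Finset.sum_biUnion hdisj]
      exact Finset.sum_congr rfl fun U _ => G.cutCard_comm _ _
    have h2 : ∑ U ∈ 𝓜, τ D (U \ T) ≤ τ D (S \ T) := by
      simp only [hτ]
      rw [← Finset.sum_biUnion hdisj]
      exact Finset.sum_le_sum_of_subset_of_nonneg hZS
        fun v _ _ => endLoad_nonneg (fun _ _ => zero_le_one) v
    have h3 : τ D S = τ D (S \ T) + τ D T := (Finset.sum_sdiff hTS).symm
    have h4 : τ D S = 2 * D.card := sum_endLoad_eq_two_mul_card hSD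
    have h5 := Finset.sum_le_sum hZcut
    rw [← Finset.mul_sum, Finset.sum_add_distrib] at h5
    omega
  have hTcut : G.cutCard T (S \ T) ≤ 2 * D.card := by
    have h3 : τ D S = τ D (S \ T) + τ D T := (Finset.sum_sdiff hTS).symm
    have h4 : τ D S = 2 * D.card := sum_endLoad_eq_two_mul_card hSD
    have := hτ0 (S \ T)
    omega
  set y : Finset V → ι → ℝ := fun W d => (if s d ∈ W then q d else 0) + if t d ∈ W then q d else 0
    with hy
  have hy0 : ∀ W, ∀ d ∈ Dm, 0 ≤ y W d := fun W d hd => by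
    have := hq0 d hd
    simp only [hy]
    split_ifs <;> linarith
  have hyW : ∀ W, ∑ d ∈ Dm, y W d = ∑ v ∈ W, endLoad s t q Dm v := fun W =>
    (sum_endLoad s t q Dm W).symm
  have hpt : ∀ d ∈ Dm, q d ≤ (if d ∈ D then 1 else 0) + y T d +
      2⁻¹ * ∑ U ∈ 𝓜, y (U \ T) d := by
    intro d hd
    have h1 := hq0 d hd
    have h2 := hy0 T d hd
    have h3 : 0 ≤ ∑ U ∈ 𝓜, y (U \ T) d := Finset.sum_nonneg fun U _ => hy0 _ d hd
    by_cases hdD : d ∈ D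
    · have := hq1 d hd
      simp only [hdD, if_true]
      linarith
    · simp only [hdD, if_false]
      rcases hcover d hd hdD with h | ⟨U, hU, hsU, htU⟩
      · have : q d ≤ y T d := by
          simp only [hy]
          rcases h with h | h <;> simp only [h, if_true] <;> split_ifs <;> linarith
        linarith
      · have hUM : U ∈ 𝓜 := Finset.mem_filter.2 ⟨hU.1, hU, d, hd, hsU, htU⟩
        have h4 := Finset.single_le_sum (f := fun U => y (U \ T) d)
          (fun U _ => hy0 _ d hd) hUM
        have h5 : y (U \ T) d = q d + q d := by simp only [hy, hsU, htU, if_true]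
        linarith
  have hsum := Finset.sum_le_sum hpt
  rw [Finset.sum_add_distrib, Finset.sum_add_distrib, ← Finset.mul_sum, Finset.sum_comm (s := Dm),
    hyW, Finset.sum_ite_mem, Finset.inter_eq_right.2 hDD] at hsum
  have h1 := hcut T hTS hwT
  have h2 : ∑ U ∈ 𝓜, ∑ d ∈ Dm, y (U \ T) d ≤
      ((∑ U ∈ 𝓜, G.cutCard (U \ T) (S \ (U \ T)) : ℤ) : ℝ) := by
    rw [Int.cast_sum]
    refine Finset.sum_le_sum fun U hU => ?_
    obtain ⟨hUS, hTU, hwU, -⟩ := (mem𝓕 U).1 (Finset.mem_filter.1 hU).1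
    rw [hyW]
    exact hcut _ (Finset.sdiff_subset.trans hUS) (by simp [hwU])
  have h3 : ((∑ U ∈ 𝓜, G.cutCard (U \ T) (S \ (U \ T)) : ℤ) : ℝ) ≤ 6 * D.card := by
    exact_mod_cast htot
  have h4 : (G.cutCard T (S \ T) : ℝ) ≤ 2 * D.card := by exact_mod_cast hTcut
  simp only [Finset.sum_const, nsmul_eq_mul, mul_one] at hsum
  linarith

/-- If, for fractional demands inside `S`, boundaries of sets avoiding `w` dominate the end loads,
then a constant fraction of the total demand can be routed integrally and edge-disjointly. -/
theorem hub_routing [Fintype V] [DecidableEq ι] {G : SimpleGraph V} {s t : ι → V} {q : ι → ℝ}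
    {w : V} (S : Finset V) (Dm : Finset ι)
    (hS : ∀ d ∈ Dm, s d ∈ S ∧ t d ∈ S) (hq0 : ∀ d ∈ Dm, 0 < q d) (hq1 : ∀ d ∈ Dm, q d ≤ 1)
    (hcut : ∀ W ⊆ S, w ∉ W → ∑ v ∈ W, endLoad s t q Dm v ≤ G.cutCard W (S \ W)) :
    ∃ D ⊆ Dm, RoutableIn G s t S D ∧ ∑ d ∈ Dm, q d ≤ 6 * D.card := by
  classical
  induction S using Finset.strongInduction generalizing Dm with
  | H S ih =>
  by_cases htwo : ∀ W ⊆ S, w ∉ W → ∀ d ∈ Dm, s d ∈ W → t d ∈ W → 2 ≤ G.cutCard W (S \ W)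
  · exact hub_routing_of_two_le hS hq0 hq1 hcut htwo
  push Not at htwo
  obtain ⟨W, hWS, hwW, d, hd, hsW, htW, hW2⟩ := htwo
  have hW1 : G.cutCard W (S \ W) ≤ 1 := by omega
  have hq0' : ∀ d ∈ Dm, 0 ≤ q d := fun d hd => (hq0 d hd).le
  set Dm' := Dm.filter fun d => s d ∉ W ∧ t d ∉ W with hDm'
  have hsub : Dm' ⊆ Dm := Finset.filter_subset _ _
  obtain ⟨D, hD, hDr, hDq⟩ := ih (S \ W) (Finset.sdiff_ssubset hWS ⟨_, hsW⟩) Dm'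
    (fun d hd => by
      obtain ⟨h1, h2, h3⟩ := Finset.mem_filter.1 hd
      simp [hS d h1, h2, h3])
    (fun d hd => hq0 d (hsub hd)) (fun d hd => hq1 d (hsub hd)) (by
      intro X hX hwX
      have hXS : X ⊆ S := hX.trans Finset.sdiff_subset
      have hdis : Disjoint W X := Finset.disjoint_left.2 fun v hv hv' =>
        (Finset.mem_sdiff.1 (hX hv')).2 hv
      have hmono : ∑ v ∈ X, endLoad s t q Dm' v ≤ ∑ v ∈ X, endLoad s t q Dm v :=
        Finset.sum_le_sum fun v _ => endLoad_mono hq0' hsub v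
      have e1 := G.cutCard_right_split X (show (S \ W) \ X ⊆ S \ X from
        Finset.sdiff_subset_sdiff Finset.sdiff_subset le_rfl)
      have e2 : (S \ X) \ ((S \ W) \ X) = W := by
        ext v; have := @hWS v; have := @hX v
        simp only [mem_sdiff] at *; tauto
      rw [e2] at e1
      by_cases h0 : G.cutCard X W = 0
      · refine hmono.trans ((hcut X hXS hwX).trans ?_)
        rw [e1, h0, add_zero]
      · have hle : ∑ v ∈ X, endLoad s t q Dm v ≤ ∑ v ∈ W ∪ X, endLoad s t q Dm v :=
          Finset.sum_le_sum_of_subset_of_nonneg Finset.subset_union_right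
            fun v _ _ => endLoad_nonneg hq0' v
        refine hmono.trans (hle.trans ((hcut _ (Finset.union_subset hWS hXS)
          (by simp [hwW, hwX])).trans ?_))
        have e3 : S \ (W ∪ X) = (S \ W) \ X := by
          ext v; simp only [mem_sdiff, mem_union]; tauto
        have e4 := G.cutCard_right_split W hX
        have e5 := G.cutCard_nonneg X W
        have e6 := G.cutCard_nonneg W ((S \ W) \ X)
        rw [e3, SimpleGraph.cutCard_union_left _ _ hdis]
        rw [G.cutCard_comm W X] at e4
        have : G.cutCard W ((S \ W) \ X) = 0 := by omega
        rw [this, zero_add])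
  have hroute : RoutableIn G s t W {d} :=
    ⟨fun _ => G.within W, fun _ _ => le_rfl,
      fun a ha b hb hab => absurd ((Finset.mem_singleton.1 ha).trans
        (Finset.mem_singleton.1 hb).symm) hab,
      fun a ha => by
        rw [Finset.mem_singleton.1 ha]
        exact SimpleGraph.reachable_of_cutCard_le_one hq0 hcut hWS hwW hW1 hd hsW htW⟩
  refine ⟨D ∪ {d}, Finset.union_subset (hD.trans hsub) (by simpa using hd),
    hDr.union hroute Finset.sdiff_subset hWS Finset.sdiff_disjoint, ?_⟩
  have hdD : Disjoint D {d} := by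
    rw [Finset.disjoint_singleton_right]
    exact fun h => (Finset.mem_filter.1 (hD h)).2.1 hsW
  rw [Finset.card_union_of_disjoint hdD, Finset.card_singleton]
  have h1 : ∑ d ∈ Dm, q d ≤ ∑ d ∈ Dm', q d + ∑ v ∈ W, endLoad s t q Dm v := by
    rw [sum_endLoad, hDm', Finset.sum_filter, ← Finset.sum_add_distrib]
    refine Finset.sum_le_sum fun d hd => ?_
    have := hq0' d hd
    by_cases h1 : s d ∈ W <;> by_cases h2 : t d ∈ W <;> simp [h1, h2, this]
  have h2 := hcut W hWS hwW
  have h3 : (G.cutCard W (S \ W) : ℝ) ≤ 1 := by exact_mod_cast hW1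
  push_cast
  linarith

end

namespace SimpleGraph

/-- A set of vertices containing every path between any two of its elements. -/
def PathConvex {B : Type} (T : SimpleGraph B) (C : Set B) : Prop :=
  ∀ a ∈ C, ∀ b ∈ C, ∀ q : T.Walk a b, q.IsPath → ∀ x ∈ q.support, x ∈ C

namespace PathConvex

variable {B : Type} {T : SimpleGraph B} {C C' C'' : Set B}

theorem univ (T : SimpleGraph B) : T.PathConvex Set.univ :=
  fun _ _ _ _ _ _ _ _ => Set.mem_univ _

theorem inter (h : T.PathConvex C) (h' : T.PathConvex C') : T.PathConvex (C ∩ C') :=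
  fun a ha b hb q hq x hx => ⟨h a ha.1 b hb.1 q hq x hx, h' a ha.2 b hb.2 q hq x hx⟩

theorem mem_union_of_path (hT : T.IsTree) (h : T.PathConvex C) (h' : T.PathConvex C') {a b p : B}
    (ha : a ∈ C) (hb : b ∈ C') (hp : p ∈ C) (hp' : p ∈ C') (q : T.Walk a b) (hq : q.IsPath)
    {x : B} (hx : x ∈ q.support) : x ∈ C ∪ C' := by
  classical
  obtain ⟨q₁, hq₁⟩ := hT.connected.exists_isPath a p
  obtain ⟨q₂, hq₂⟩ := hT.connected.exists_isPath p b
  have hq' : q = (q₁.append q₂).bypass :=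
    (hT.existsUnique_path a b).unique hq (Walk.bypass_isPath _)
  rw [hq'] at hx
  rcases (Walk.mem_support_append_iff _ _).1 (Walk.support_bypass_subset_support _ hx) with hx | hx
  · exact Or.inl (h a ha p hp q₁ hq₁ x hx)
  · exact Or.inr (h' p hp' b hb q₂ hq₂ x hx)

theorem union (hT : T.IsTree) (h : T.PathConvex C) (h' : T.PathConvex C')
    (hne : (C ∩ C').Nonempty) : T.PathConvex (C ∪ C') := by
  obtain ⟨p, hp, hp'⟩ := hne
  rintro a (ha | ha) b (hb | hb) q hq x hx
  · exact Or.inl (h a ha b hb q hq x hx)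
  · exact mem_union_of_path hT h h' ha hb hp hp' q hq hx
  · exact (mem_union_of_path hT h' h ha hb hp' hp q hq hx).symm
  · exact Or.inr (h' a ha b hb q hq x hx)

/-- The Helly property of subtrees. -/
theorem helly (hT : T.IsTree) (h : T.PathConvex C) (h' : T.PathConvex C')
    (h'' : T.PathConvex C'') (h1 : (C ∩ C').Nonempty) (h2 : (C ∩ C'').Nonempty)
    (h3 : (C' ∩ C'').Nonempty) : ∃ x, x ∈ C ∧ x ∈ C' ∧ x ∈ C'' := by
  obtain ⟨a, ha, ha'⟩ := h1
  obtain ⟨b, hb, hb'⟩ := h2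
  obtain ⟨p, hp, hp'⟩ := h3
  by_contra! hno
  obtain ⟨q, hq⟩ := hT.connected.exists_isPath a b
  obtain ⟨d, hd, hd1, hd2⟩ := q.exists_boundary_dart C' ha' fun hb'' => hno b hb hb'' hb'
  have hs1 := q.dart_fst_mem_support_of_mem_darts hd
  have hs2 := q.dart_snd_mem_support_of_mem_darts hd
  have hC1 : d.fst ∉ C'' := hno _ (h a ha b hb q hq _ hs1) hd1
  have hC2 : d.snd ∈ C'' := (mem_union_of_path hT h' h'' ha' hb' hp hp' q hq hs2).resolve_left hd2
  obtain ⟨r, hr⟩ := hT.connected.exists_isPath d.fst p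
  have hr' : (Walk.cons d.adj.symm r).IsPath :=
    (Walk.cons_isPath_iff _ _).2 ⟨hr, fun hmem => hd2 (h' _ hd1 p hp r hr _ hmem)⟩
  exact hC1 (h'' _ hC2 p hp' _ hr' _ (by simp))

end PathConvex

end SimpleGraph

namespace TreeDecomp

variable {V : Type} {G : SimpleGraph V} (td : TreeDecomp G)

/-- The nodes of the decomposition tree whose bags meet `O`. -/
def nodes (O : Finset V) : Set td.B := {t | ∃ v ∈ O, v ∈ td.bag t}

theorem nodes_singleton_convex (v : V) : td.T.PathConvex (td.nodes {v}) := by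
  rintro a ⟨u, hu, ha⟩ b ⟨u', hu', hb⟩ q hq x hx
  rw [Finset.mem_singleton] at hu hu'
  subst hu hu'
  exact ⟨_, Finset.mem_singleton_self _, td.coherent _ a b ha hb q hq x hx⟩

theorem nodes_empty : td.nodes ∅ = ∅ := by
  ext t; simp [nodes]

theorem nodes_insert [DecidableEq V] (v : V) (O : Finset V) :
    td.nodes (insert v O) = td.nodes O ∪ td.nodes {v} := by
  ext t; simp [nodes, or_comm]

variable {td}

theorem mem_nodes_singleton {v : V} {t : td.B} : t ∈ td.nodes {v} ↔ v ∈ td.bag t := by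
  simp [nodes]

theorem meets_nodes_of_adj {u v : V} {O : Finset V} (hu : u ∈ O) (h : G.Adj v u) :
    ∃ t ∈ td.nodes O, v ∈ td.bag t := by
  obtain ⟨t, hv, hu'⟩ := td.cover_edge h
  exact ⟨t, ⟨u, hu, hu'⟩, hv⟩

theorem meets_nodes_of_mem {v : V} {O : Finset V} (hv : v ∈ O) :
    ∃ t ∈ td.nodes O, v ∈ td.bag t := by
  obtain ⟨t, ht⟩ := td.cover_vertex v
  exact ⟨t, ⟨v, hv, ht⟩, ht⟩

theorem nodes_mono {O O' : Finset V} (h : O ⊆ O') : td.nodes O ⊆ td.nodes O' :=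
  fun _ ⟨v, hv, ht⟩ => ⟨v, h hv, ht⟩

variable [DecidableEq V]

theorem nodes_insert_convex {v : V} {O : Finset V} (hO : td.T.PathConvex (td.nodes O))
    (hv : ∃ t ∈ td.nodes O, v ∈ td.bag t) : td.T.PathConvex (td.nodes (insert v O)) := by
  rw [nodes_insert]
  obtain ⟨t, ht, ht'⟩ := hv
  exact hO.union td.isTree (td.nodes_singleton_convex v) ⟨t, ht, mem_nodes_singleton.2 ht'⟩

end TreeDecomp

section

variable {V : Type} [DecidableEq V]

/-- The boundary of `Z` inside `U` minus `c` times the weight of `Z`. -/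
noncomputable def cutExcess (G : SimpleGraph V) (x : V → ℝ) (c : ℝ) (U Z : Finset V) : ℝ :=
  G.cutCard Z (U \ Z) - c * ∑ v ∈ Z, x v

/-- If removing `A` from `Z` does not decrease the excess, then few edges leave `Z` from `A`. -/
theorem cutCard_le_of_cutExcess_le {G : SimpleGraph V} {x : V → ℝ} {c : ℝ} {U Z A : Finset V}
    (hZ : Z ⊆ U) (hA : A ⊆ Z) (h : cutExcess G x c U Z ≤ cutExcess G x c U (Z \ A)) :
    (G.cutCard A (U \ Z) : ℝ) ≤ G.cutCard A (Z \ A) + c * ∑ v ∈ A, x v := by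
  have h1 := G.cutCard_left_split (U \ Z) hA
  have h2 := G.cutCard_right_split (Z \ A) (show U \ Z ⊆ U \ (Z \ A) from
    Finset.sdiff_subset_sdiff le_rfl Finset.sdiff_subset)
  have e : (U \ (Z \ A)) \ (U \ Z) = A := by
    ext v; have := @hZ v; have := @hA v; simp only [mem_sdiff]; tauto
  rw [e, G.cutCard_comm _ A] at h2
  have h3 := Finset.sum_sdiff (f := x) hA
  unfold cutExcess at h
  rw [h1, h2, ← h3] at h
  push_cast at h
  linarith

theorem cutCard_split_outside {G : SimpleGraph V} {U Z A : Finset V} (hZ : Z ⊆ U) (hA : A ⊆ Z) :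
    G.cutCard A (U \ A) = G.cutCard A (Z \ A) + G.cutCard A (U \ Z) := by
  rw [G.cutCard_right_split A (show Z \ A ⊆ U \ A from Finset.sdiff_subset_sdiff hZ le_rfl)]
  congr 2
  ext v; have := @hZ v; have := @hA v; simp only [mem_sdiff]; tauto

/-- A set of negative excess can be enlarged so that the rest `O` of `U` occupies a subtree. -/
theorem exists_convex_complement {G : SimpleGraph V} (td : TreeDecomp G) {x : V → ℝ}
    (hx : ∀ v, 0 ≤ x v) {c : ℝ} (hc : 0 ≤ c) {U O₀ D Z₁ : Finset V} (hO₀ : O₀ ⊆ U)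
    (hconv : td.T.PathConvex (td.nodes O₀)) (hD : D ⊆ U) (hdis : Disjoint O₀ D)
    (hmeet : ∀ v ∈ U, v ∉ D → ∃ t ∈ td.nodes O₀, v ∈ td.bag t)
    (hZ₁ : Z₁ ⊆ D) (hneg : cutExcess G x c U Z₁ < 0) :
    ∃ O, O₀ ⊆ O ∧ O ⊆ U ∧ td.T.PathConvex (td.nodes O) ∧ U \ O ⊆ D ∧
      cutExcess G x c U (U \ O) < 0 ∧
      ∀ W ⊆ U \ O, cutExcess G x c U (U \ O) ≤ cutExcess G x c U W := by
  classical
  obtain ⟨Z, hZ, hZmin⟩ := Finset.exists_min_image D.powerset (cutExcess G x c U)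
    ⟨∅, Finset.empty_mem_powerset D⟩
  rw [Finset.mem_powerset] at hZ
  have hO₀Z : O₀ ⊆ U \ Z := fun v hv => Finset.mem_sdiff.2
    ⟨hO₀ hv, fun h => Finset.disjoint_left.1 hdis hv (hZ h)⟩
  obtain ⟨O, hO, hOmax⟩ := Finset.exists_max_image
    ((U \ Z).powerset.filter fun O => O₀ ⊆ O ∧ td.T.PathConvex (td.nodes O)) Finset.card
    ⟨O₀, by simp [hO₀Z, hconv]⟩
  simp only [Finset.mem_filter, Finset.mem_powerset] at hO hOmax
  obtain ⟨hOM, hO₀O, hOc⟩ := hO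
  have hOU : O ⊆ U := hOM.trans Finset.sdiff_subset
  have hno : ∀ v ∈ U \ Z, v ∉ O → ¬ ∃ t ∈ td.nodes O, v ∈ td.bag t := by
    intro v hv hvO hh
    have := hOmax (insert v O) ⟨Finset.insert_subset hv hOM,
      hO₀O.trans (Finset.subset_insert _ _), TreeDecomp.nodes_insert_convex hOc hh⟩
    rw [Finset.card_insert_of_notMem hvO] at this
    omega
  have hZO : Z ⊆ U \ O := fun v hv => Finset.mem_sdiff.2
    ⟨hD (hZ hv), fun h => (Finset.mem_sdiff.1 (hOM h)).2 hv⟩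
  have hOD : U \ O ⊆ D := by
    intro v hv
    rw [Finset.mem_sdiff] at hv
    by_contra hvD
    obtain ⟨t, ht, ht'⟩ := hmeet v hv.1 hvD
    exact hno v (Finset.mem_sdiff.2 ⟨hv.1, fun h => hvD (hZ h)⟩) hv.2
      ⟨t, TreeDecomp.nodes_mono hO₀O ht, ht'⟩
  have hle : cutExcess G x c U (U \ O) ≤ cutExcess G x c U Z := by
    unfold cutExcess
    have h1 := G.cutCard_left_split O hZO
    have h0 : G.cutCard ((U \ O) \ Z) O = 0 := SimpleGraph.cutCard_eq_zero fun a ha b hb hab => by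
      simp only [mem_sdiff] at ha
      exact hno a (Finset.mem_sdiff.2 ⟨ha.1.1, ha.2⟩) ha.1.2
        (TreeDecomp.meets_nodes_of_adj hb hab)
    have h2 := G.cutCard_mono_right Z hOM
    have h3 : ∑ v ∈ Z, x v ≤ ∑ v ∈ U \ O, x v :=
      Finset.sum_le_sum_of_subset_of_nonneg hZO fun v _ _ => hx v
    have h4 := mul_le_mul_of_nonneg_left h3 hc
    have h5 : (G.cutCard (U \ O) O : ℝ) ≤ G.cutCard Z (U \ Z) := by
      exact_mod_cast (by omega)
    rw [Finset.sdiff_sdiff_eq_self hOU]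
    linarith
  refine ⟨O, hO₀O, hOU, hOc, hOD, ?_, fun W hW => ?_⟩
  · exact (hle.trans (hZmin Z₁ (Finset.mem_powerset.2 hZ₁))).trans_lt hneg
  · exact hle.trans (hZmin W (Finset.mem_powerset.2 (hW.trans hOD)))

/-- In a weighted graph with a tree decomposition of small width there is a cheap set `S` whose
weight is well linked to some hub `w`. -/
theorem exists_hub {G : SimpleGraph V} (td : TreeDecomp G) {x : V → ℝ} (hx : ∀ v, 0 ≤ x v)
    (j : ℕ) : ∀ (T₀ : Set td.B), td.T.PathConvex T₀ → ∀ (ρ : ℝ), 0 < ρ → ∀ (U : Finset V),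
      (∀ t ∈ T₀, (td.bag t ∩ U).card ≤ j) →
      (∀ W ⊆ U, (∀ v ∈ W, ∀ t ∈ T₀, v ∉ td.bag t) →
        ρ * ∑ v ∈ W, x v ≤ G.cutCard W (U \ W)) →
      0 < ∑ v ∈ U, x v →
      ∃ S ⊆ U, ∃ w ∈ S, 0 < ∑ v ∈ S, x v ∧ (G.cutCard S (U \ S) : ℝ) ≤ ρ * ∑ v ∈ S, x v ∧
        ∀ W ⊆ S, w ∉ W → ρ / 3 ^ j * ∑ v ∈ W, x v ≤ G.cutCard W (S \ W) := by
  classical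
  induction j with
  | zero =>
    intro T₀ _ ρ hρ U hcard hcut hpos
    have := hcut U le_rfl fun v hv t ht hvt => by
      have h := hcard t ht
      rw [Nat.le_zero, Finset.card_eq_zero] at h
      exact Finset.notMem_empty v (h ▸ Finset.mem_inter.2 ⟨hvt, hv⟩)
    rw [Finset.sdiff_self, SimpleGraph.cutCard_empty_right, Int.cast_zero] at this
    exact absurd (mul_pos hρ hpos) (not_lt.2 this)
  | succ j ihj =>
  intro T₀ hT₀ ρ hρ U
  induction U using Finset.strongInduction with
  | H U ihU =>
  intro hcard hcut hpos
  have hsum0 : ∀ A : Finset V, 0 ≤ ∑ v ∈ A, x v := fun A => Finset.sum_nonneg fun v _ => hx v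
  obtain ⟨w, hwU, t₀, ht₀, hwt₀⟩ : ∃ w ∈ U, ∃ t ∈ T₀, w ∈ td.bag t := by
    by_contra! hno
    have := hcut U le_rfl hno
    rw [Finset.sdiff_self, SimpleGraph.cutCard_empty_right, Int.cast_zero] at this
    exact absurd (mul_pos hρ hpos) (not_lt.2 this)
  set c := ρ / 3 with hc
  have hc0 : 0 < c := by positivity
  by_cases hall : ∀ Z ⊆ U.erase w, 0 ≤ cutExcess G x c U Z
  · refine ⟨U, le_rfl, w, hwU, hpos, ?_, fun W hW hwW => ?_⟩
    · rw [Finset.sdiff_self, SimpleGraph.cutCard_empty_right, Int.cast_zero]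
      exact (mul_pos hρ hpos).le
    · have h1 := hall W (Finset.subset_erase.2 ⟨hW, hwW⟩)
      unfold cutExcess at h1
      have h2 : ρ / 3 ^ (j + 1) ≤ c := by
        rw [hc]
        exact div_le_div_of_nonneg_left hρ.le (by norm_num)
          (le_self_pow₀ (by norm_num) (by omega))
      have := mul_le_mul_of_nonneg_right h2 (hsum0 W)
      linarith
  push Not at hall
  obtain ⟨Z₁, hZ₁, hneg₁⟩ := hall
  obtain ⟨O₁, h₁⟩ := exists_convex_complement td hx hc0.le (O₀ := {w}) (D := U.erase w)
    (by simpa using hwU) (td.nodes_singleton_convex w) (Finset.erase_subset _ _) (by simp)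
    (fun v hv hvD => TreeDecomp.meets_nodes_of_mem (by simpa [hv] using hvD)) hZ₁ hneg₁
  obtain ⟨O, hO, hOmax⟩ := Finset.exists_max_image
    (U.powerset.filter fun O => w ∈ O ∧ td.T.PathConvex (td.nodes O) ∧
      cutExcess G x c U (U \ O) < 0 ∧
      ∀ W ⊆ U \ O, cutExcess G x c U (U \ O) ≤ cutExcess G x c U W) Finset.card
    ⟨O₁, Finset.mem_filter.2 ⟨Finset.mem_powerset.2 h₁.2.1,
      Finset.singleton_subset_iff.1 h₁.1, h₁.2.2.1, h₁.2.2.2.2⟩⟩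
  simp only [Finset.mem_filter, Finset.mem_powerset] at hO hOmax
  obtain ⟨hOU, hwO, hOc, hneg, hmin⟩ := hO
  set Z := U \ O with hZ
  have hZU : Z ⊆ U := Finset.sdiff_subset
  have hUZ : U \ Z = O := Finset.sdiff_sdiff_eq_self hOU
  have hposZ : 0 < ∑ v ∈ Z, x v := by
    unfold cutExcess at hneg
    have h0 : (0 : ℝ) ≤ G.cutCard Z (U \ Z) := by exact_mod_cast G.cutCard_nonneg _ _
    exact pos_of_mul_pos_right (by linarith : 0 < c * ∑ v ∈ Z, x v) hc0.le
  have hsplit : ∀ A ⊆ Z, G.cutCard A (U \ A) = G.cutCard A (Z \ A) + G.cutCard A O :=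
    fun A hA => by rw [cutCard_split_outside hZU hA, hUZ]
  have hswap : ∀ A ⊆ Z, (G.cutCard A O : ℝ) ≤ G.cutCard A (Z \ A) + c * ∑ v ∈ A, x v :=
    fun A hA => by
      rw [← hUZ]
      exact cutCard_le_of_cutExcess_le hZU hA (hmin _ Finset.sdiff_subset)
  set D := Z.filter fun v => ¬ ∃ t ∈ td.nodes O, v ∈ td.bag t with hD
  have hDO : ∀ A ⊆ D, G.cutCard A O = 0 := fun A hA =>
    SimpleGraph.cutCard_eq_zero fun a ha b hb hab =>
      (Finset.mem_filter.1 (hA ha)).2 (TreeDecomp.meets_nodes_of_adj hb hab)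
  have hDZ : D ⊆ Z := Finset.filter_subset _ _
  by_cases hDeq : D = Z
  · obtain ⟨S, hSZ, v, hvS, hS⟩ := ihU Z (Finset.ssubset_iff_subset_ne.2 ⟨hZU, fun h => by
        rw [← h, hZ] at hwU
        exact (Finset.mem_sdiff.1 hwU).2 hwO⟩)
      (fun t ht => (Finset.card_le_card (Finset.inter_subset_inter_left hZU)).trans (hcard t ht))
      (fun W hW hav => by
        have := hcut W (hW.trans hZU) hav
        rwa [hsplit W hW, hDO W (hDeq ▸ hW), add_zero] at this) hposZ
    refine ⟨S, hSZ.trans hZU, v, hvS, hS.1, ?_, hS.2.2⟩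
    rw [hsplit S hSZ, hDO S (hDeq ▸ hSZ), add_zero]
    exact hS.2.1
  have hDpos : ∀ W ⊆ D, 0 ≤ cutExcess G x c U W := by
    intro W hW
    by_contra! hlt
    obtain ⟨O', hOO', hO'U, hO'c, hO'D, hO'neg, hO'min⟩ := exists_convex_complement td hx hc0.le
      hOU hOc (hDZ.trans hZU)
      (Finset.disjoint_right.2 fun v hv hvO => (Finset.mem_sdiff.1 (hDZ hv)).2 hvO)
      (fun v hvU hvD => by
        by_cases hvO : v ∈ O
        · exact TreeDecomp.meets_nodes_of_mem hvO
        · by_contra hh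
          exact hvD (Finset.mem_filter.2 ⟨Finset.mem_sdiff.2 ⟨hvU, hvO⟩, hh⟩)) hW hlt
    have h1 := hOmax O' ⟨hO'U, hOO' hwO, hO'c, hO'neg, hO'min⟩
    have h2 := Finset.eq_of_subset_of_card_le hOO' h1
    rw [← h2] at hO'D
    exact hDeq (hDZ.antisymm hO'D)
  obtain ⟨S, hSZ, v, hvS, hSpos, hScut, hSlink⟩ := ihj (T₀ ∩ td.nodes O) (hT₀.inter hOc) c hc0 Z
    (by
      rintro t ⟨ht, u, hu, hut⟩
      have h1 := hcard t ht
      have h2 : td.bag t ∩ Z ⊂ td.bag t ∩ U := by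
        refine Finset.ssubset_iff_subset_ne.2 ⟨Finset.inter_subset_inter_left hZU, fun h => ?_⟩
        have : u ∈ td.bag t ∩ Z := h ▸ Finset.mem_inter.2 ⟨hut, hOU hu⟩
        exact (Finset.mem_sdiff.1 (Finset.mem_inter.1 this).2).2 hu
      have := Finset.card_lt_card h2
      omega)
    (by
      intro W hWZ hav
      obtain ⟨C, hC, hCmax⟩ := Finset.exists_max_image
        (W.powerset.filter fun C => td.T.PathConvex (T₀ ∪ td.nodes C) ∧
          Disjoint (td.nodes C) (td.nodes O)) Finset.card
        ⟨∅, by simp [TreeDecomp.nodes_empty, hT₀]⟩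
      simp only [Finset.mem_filter, Finset.mem_powerset] at hC hCmax
      obtain ⟨hCW, hCc, hCO⟩ := hC
      have hCD : C ⊆ D := fun u hu => Finset.mem_filter.2 ⟨hWZ (hCW hu), by
        rintro ⟨t, ht, hut⟩
        exact Set.disjoint_left.1 hCO ⟨u, hu, hut⟩ ht⟩
      have hnot : ∀ u ∈ W \ C, ∀ t ∈ T₀ ∪ td.nodes C, u ∉ td.bag t := by
        intro u hu t ht hut
        rw [Finset.mem_sdiff] at hu
        have hconv : td.T.PathConvex (T₀ ∪ td.nodes (insert u C)) := by
          rw [TreeDecomp.nodes_insert, ← Set.union_assoc]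
          exact hCc.union td.isTree (td.nodes_singleton_convex u)
            ⟨t, ht, TreeDecomp.mem_nodes_singleton.2 hut⟩
        have hmeets : (td.nodes {u} ∩ td.nodes O).Nonempty := by
          by_contra hemp
          have hdisj : Disjoint (td.nodes (insert u C)) (td.nodes O) := by
            rw [TreeDecomp.nodes_insert, Set.disjoint_union_left]
            exact ⟨hCO, Set.disjoint_iff_inter_eq_empty.2 (Set.not_nonempty_iff_eq_empty.1 hemp)⟩
          have := hCmax (insert u C) ⟨Finset.insert_subset hu.1 hCW, hconv, hdisj⟩
          rw [Finset.card_insert_of_notMem hu.2] at this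
          omega
        obtain ⟨m, hm1, hm2, hm3⟩ := hCc.helly td.isTree (td.nodes_singleton_convex u) hOc
          ⟨t, ht, TreeDecomp.mem_nodes_singleton.2 hut⟩ ⟨t₀, Or.inl ht₀, w, hwO, hwt₀⟩ hmeets
        have hmT : m ∈ T₀ := hm1.resolve_right fun h => Set.disjoint_left.1 hCO h hm3
        exact hav u hu.1 m ⟨hmT, hm3⟩ (TreeDecomp.mem_nodes_singleton.1 hm2)
      have hAZ : W \ C ⊆ Z := Finset.sdiff_subset.trans hWZ
      have h0 : G.cutCard (W \ C) C = 0 := SimpleGraph.cutCard_eq_zero fun a ha b hb hab => by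
        obtain ⟨t, ht, hat⟩ := TreeDecomp.meets_nodes_of_adj (td := td) hb hab
        exact hnot a ha t (Or.inr ht) hat
      have h1 := hcut (W \ C) (hAZ.trans hZU) fun u hu t ht => hnot u hu t (Or.inl ht)
      have h2 := hsplit (W \ C) hAZ
      have h3 := hswap (W \ C) hAZ
      have h4 := hDpos C hCD
      unfold cutExcess at h4
      rw [hsplit C (hCD.trans hDZ), hDO C hCD, add_zero] at h4
      have h5 := G.cutCard_left_split (Z \ W) hCW
      have h6 := G.cutCard_right_split C
        (show Z \ W ⊆ Z \ C from Finset.sdiff_subset_sdiff le_rfl hCW)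
      have e6 : (Z \ C) \ (Z \ W) = W \ C := by
        ext v; have := @hWZ v; simp only [mem_sdiff]; tauto
      have h7 := G.cutCard_right_split (W \ C)
        (show Z \ W ⊆ Z \ (W \ C) from Finset.sdiff_subset_sdiff le_rfl Finset.sdiff_subset)
      have e7 : (Z \ (W \ C)) \ (Z \ W) = C := by
        ext v; have := @hWZ v; have := @hCW v; simp only [mem_sdiff]; tauto
      rw [e6, G.cutCard_comm C (W \ C), h0, add_zero] at h6
      rw [e7, h0, add_zero] at h7
      rw [h2, Int.cast_add] at h1
      rw [h5, ← h6, ← h7, ← Finset.sum_sdiff hCW]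
      have h8 : ρ = 3 * c := by rw [hc]; ring
      rw [h8] at h1
      push_cast
      nlinarith)
    hposZ
  refine ⟨S, hSZ.trans hZU, v, hvS, hSpos, ?_, fun W hW hvW => ?_⟩
  · rw [hsplit S hSZ]
    have h3 := hswap S hSZ
    have h8 : ρ = 3 * c := by rw [hc]; ring
    rw [h8]
    push_cast
    linarith
  · have h := hSlink W hW hvW
    have e : ρ / 3 ^ (j + 1) = c / 3 ^ j := by rw [hc]; field_simp; ring
    rwa [e]

end

theorem one_le_ecount {α : Type} {l : List α} {e : α} (h : e ∈ l) : 1 ≤ ecount l e := by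
  classical
  unfold ecount
  exact List.count_pos_iff.2 h

theorem ecount_le_one {α : Type} {l : List α} (h : l.Nodup) (e : α) : ecount l e ≤ 1 := by
  classical
  unfold ecount
  exact List.nodup_iff_count_le_one.1 h e

theorem ecount_eq_zero {α : Type} {l : List α} {e : α} (h : e ∉ l) : ecount l e = 0 := by
  classical
  unfold ecount
  exact List.count_eq_zero_of_not_mem h

/-- Connecting pairwise edge-disjoint subgraphs give an integral routing with congestion one. -/
theorem RoutableIn.hasIntegralRouting {V : Type} {G : SimpleGraph V} {n : ℕ} {s t : Fin n → V}
    {S : Finset V} {D : Finset (Fin n)} (h : RoutableIn G s t S D) {N : ℝ} (hN : N ≤ D.card) :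
    HasIntegralRouting G s t 1 N := by
  classical
  obtain ⟨F, hF, hdis, hreach⟩ := h
  have hle : ∀ d ∈ D, F d ≤ G := fun d hd _ _ hab => (hF d hd hab).1
  choose p hp using fun d hd => (hreach d hd).exists_isPath
  refine ⟨D, fun d hd => (p d hd).mapLe (hle d hd), hN, fun e => ?_⟩
  simp only [SimpleGraph.Walk.edges_mapLe_eq_edges]
  by_cases he : ∃ d, ∃ hd : d ∈ D, e ∈ (p d hd).edges
  · obtain ⟨d, hd, hde⟩ := he
    rw [Finset.sum_eq_single ⟨d, hd⟩]
    · exact ecount_le_one (hp d hd).isTrail.edges_nodup e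
    · rintro ⟨d', hd'⟩ _ hne
      refine ecount_eq_zero fun hde' => ?_
      have h1 := SimpleGraph.disjoint_edgeSet.2
        (hdis d hd d' hd' fun h => hne (Subtype.ext h.symm))
      exact Set.disjoint_left.1 h1 ((p d hd).edges_subset_edgeSet hde)
        ((p d' hd').edges_subset_edgeSet hde')
    · simp
  · push Not at he
    rw [Finset.sum_eq_zero]
    · exact zero_le_one
    · rintro ⟨d, hd⟩ _
      exact ecount_eq_zero (he d hd)

section

variable {V : Type} [DecidableEq V] {G : SimpleGraph V}

/-- A walk inside `A` that meets both `S` and `A \ S` uses an edge between them. -/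
theorem SimpleGraph.Walk.exists_crossing_edge {a b : V} (p : G.Walk a b) {S A : Finset V}
    (hA : ∀ v ∈ p.support, v ∈ A) {u v : V} (hu : u ∈ p.support) (huS : u ∈ S)
    (hv : v ∈ p.support) (hvS : v ∉ S) :
    ∃ y ∈ S, ∃ z ∈ A \ S, G.Adj y z ∧ s(y, z) ∈ p.edges := by
  by_cases ha : a ∈ S
  · obtain ⟨d, hd, h1, h2⟩ := (p.takeUntil v hv).exists_boundary_dart (S : Set V) ha hvS
    refine ⟨d.fst, h1, d.snd, Finset.mem_sdiff.2 ⟨hA _ ?_, h2⟩, d.adj, ?_⟩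
    · exact p.support_takeUntil_subset_support hv
        ((p.takeUntil v hv).dart_snd_mem_support_of_mem_darts hd)
    · exact p.edges_takeUntil_subset_edges hv (List.mem_map.2 ⟨d, hd, rfl⟩)
  · obtain ⟨d, hd, h1, h2⟩ := (p.takeUntil u hu).exists_boundary_dart ((S : Set V)ᶜ) ha
      (fun h => h huS)
    refine ⟨d.snd, not_not.1 h2, d.fst, Finset.mem_sdiff.2 ⟨hA _ ?_, h1⟩, d.adj.symm, ?_⟩
    · exact p.support_takeUntil_subset_support hu
        ((p.takeUntil u hu).dart_fst_mem_support_of_mem_darts hd)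
    · rw [Sym2.eq_swap]
      exact p.edges_takeUntil_subset_edges hu (List.mem_map.2 ⟨d, hd, rfl⟩)

namespace FracSol

variable {n : ℕ} {s t : Fin n → V} (x : FracSol G s t)

omit [DecidableEq V] in
theorem sum_xval_le_cutCard {S R : Finset V} {I : Finset (Fin x.m)}
    (hI : ∀ i ∈ I, ∃ y ∈ S, ∃ z ∈ R, G.Adj y z ∧ s(y, z) ∈ (x.fpath i).edges) :
    ∑ i ∈ I, x.xval i ≤ G.cutCard S R := by
  classical
  have h1 : ∀ i ∈ I, x.xval i ≤ ∑ y ∈ S, ∑ z ∈ R,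
      if G.Adj y z then (ecount (x.fpath i).edges s(y, z) : ℝ) * x.xval i else 0 := by
    intro i hi
    obtain ⟨y, hy, z, hz, hyz, he⟩ := hI i hi
    have h0 : ∀ y z, (0 : ℝ) ≤
        if G.Adj y z then (ecount (x.fpath i).edges s(y, z) : ℝ) * x.xval i else 0 := fun y z => by
      have := x.nonneg i
      split_ifs <;> positivity
    refine le_trans ?_ (Finset.single_le_sum (fun y _ => Finset.sum_nonneg fun z _ => h0 y z) hy)
    refine le_trans ?_ (Finset.single_le_sum (fun z _ => h0 y z) hz)
    rw [if_pos hyz]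
    have : (1 : ℝ) ≤ ecount (x.fpath i).edges s(y, z) := by exact_mod_cast one_le_ecount he
    nlinarith [x.nonneg i]
  refine (Finset.sum_le_sum h1).trans ?_
  rw [Finset.sum_comm]
  unfold SimpleGraph.cutCard
  push_cast
  refine Finset.sum_le_sum fun y _ => ?_
  rw [Finset.sum_comm]
  refine Finset.sum_le_sum fun z _ => ?_
  by_cases h : G.Adj y z
  · simp only [h, if_true]
    refine le_trans ?_ (x.capacity s(y, z))
    exact Finset.sum_le_sum_of_subset_of_nonneg (Finset.subset_univ _)
      fun i _ _ => mul_nonneg (Nat.cast_nonneg _) (x.nonneg i)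
  · simp [h]

omit [DecidableEq V] in
theorem sum_xval_le_one (I : Finset (Fin x.m)) (d : Fin n) :
    ∑ i ∈ I with x.dem i = d, x.xval i ≤ 1 := by
  refine le_trans ?_ (x.perDemand d)
  rw [← Finset.sum_filter]
  exact Finset.sum_le_sum_of_subset_of_nonneg
    (Finset.filter_subset_filter _ (Finset.subset_univ _)) fun i _ _ => x.nonneg i

/-- The flow paths inside a well-linked set `S` can be rounded at a constant loss. -/
theorem exists_routing_of_hub [Fintype V] {S : Finset V} {w : V} {ε : ℝ} (hε : 0 < ε)
    (hε1 : ε ≤ 1) {I : Finset (Fin x.m)} (hI : ∀ i ∈ I, ∀ v ∈ (x.fpath i).support, v ∈ S)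
    (hlink : ∀ W ⊆ S, w ∉ W →
      ε * ∑ v ∈ W, endLoad (s ∘ x.dem) (t ∘ x.dem) x.xval I v ≤ G.cutCard W (S \ W)) :
    ∃ D ⊆ I.image x.dem, RoutableIn G s t S D ∧ ε * ∑ i ∈ I, x.xval i ≤ 6 * D.card := by
  classical
  set q : Fin n → ℝ := fun d => ε * ∑ i ∈ I with x.dem i = d, x.xval i with hq
  have hq0 : ∀ d, 0 ≤ q d := fun d =>
    mul_nonneg hε.le (Finset.sum_nonneg fun i _ => x.nonneg i)
  set Dm : Finset (Fin n) := Finset.univ.filter fun d => 0 < q d with hDm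
  have hDI : ∀ d ∈ Dm, ∃ i ∈ I, x.dem i = d := by
    intro d hd
    by_contra! hno
    have h1 := (Finset.mem_filter.1 hd).2
    simp only [hq] at h1
    rw [Finset.filter_eq_empty_iff.2 fun i hi => hno i hi] at h1
    simp at h1
  obtain ⟨D, hD, hr, hsum⟩ := hub_routing (G := G) (s := s) (t := t) (q := q) (w := w) S Dm
    (fun d hd => by
      obtain ⟨i, hi, rfl⟩ := hDI d hd
      exact ⟨hI i hi _ (x.fpath i).start_mem_support, hI i hi _ (x.fpath i).end_mem_support⟩)
    (fun d hd => (Finset.mem_filter.1 hd).2)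
    (fun d _ => mul_le_one₀ hε1 (Finset.sum_nonneg fun i _ => x.nonneg i) (x.sum_xval_le_one I d))
    (fun W hW hw => by
      refine le_trans ?_ (hlink W hW hw)
      rw [sum_endLoad, sum_endLoad, ← Finset.sum_fiberwise I x.dem, Finset.mul_sum]
      refine (Finset.sum_le_sum_of_subset_of_nonneg (Finset.subset_univ Dm) fun d _ _ => ?_).trans
        (Finset.sum_le_sum fun d _ => le_of_eq ?_)
      · have := hq0 d
        split_ifs <;> simp [this]
      · have : ∀ i ∈ I.filter (x.dem · = d),
            ((if (s ∘ x.dem) i ∈ W then x.xval i else 0) +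
              if (t ∘ x.dem) i ∈ W then x.xval i else 0) =
            ((if s d ∈ W then 1 else 0) + if t d ∈ W then 1 else 0) * x.xval i := by
          intro i hi
          obtain rfl := (Finset.mem_filter.1 hi).2
          simp only [Function.comp]
          split_ifs <;> ring
        rw [Finset.sum_congr rfl this, ← Finset.mul_sum]
        simp only [hq]
        split_ifs <;> ring)
  refine ⟨D, fun d hd => ?_, hr, ?_⟩
  · obtain ⟨i, hi, h⟩ := hDI d (hD hd)
    exact Finset.mem_image.2 ⟨i, hi, h⟩
  · have h1 : ∑ d ∈ Dm, q d = ∑ d, q d :=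
      Finset.sum_subset (Finset.subset_univ _) fun d _ hd => by
        have : ¬ 0 < q d := fun h => hd (Finset.mem_filter.2 ⟨Finset.mem_univ _, h⟩)
        linarith [hq0 d]
    rw [h1] at hsum
    simp only [hq] at hsum
    rwa [← Finset.mul_sum, Finset.sum_fiberwise] at hsum

theorem exists_routing [Fintype V] (td : TreeDecomp G) {k : ℕ}
    (hk : ∀ b, (td.bag b).card ≤ k + 1) (A : Finset V) (I : Finset (Fin x.m))
    (hI : ∀ i ∈ I, ∀ v ∈ (x.fpath i).support, v ∈ A) :
    ∃ D ⊆ I.image x.dem, RoutableIn G s t A D ∧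
      ∑ i ∈ I, x.xval i ≤ 193 * 3 ^ k * D.card := by
  classical
  induction A using Finset.strongInduction generalizing I with
  | H A ih =>
  by_cases hpos : ∑ i ∈ I, x.xval i ≤ 0
  · exact ⟨∅, Finset.empty_subset _, ⟨fun _ => ⊥, by simp, by simp, by simp⟩, by simpa using hpos⟩
  push Not at hpos
  set y : V → ℝ := endLoad (s ∘ x.dem) (t ∘ x.dem) x.xval I with hy
  have hy0 : ∀ v, 0 ≤ y v := fun v => endLoad_nonneg (fun i _ => x.nonneg i) v
  have hyA : ∑ v ∈ A, y v = ∑ i ∈ I, (x.xval i + x.xval i) := by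
    rw [hy, sum_endLoad]
    refine Finset.sum_congr rfl fun i hi => ?_
    simp [hI i hi _ (x.fpath i).start_mem_support, hI i hi _ (x.fpath i).end_mem_support]
  obtain ⟨S, hSA, w, hwS, hySpos, hScut, hSlink⟩ := exists_hub td hy0 (k + 1) Set.univ
    (SimpleGraph.PathConvex.univ _) (1 / 8) (by norm_num) A
    (fun b _ => (Finset.card_le_card Finset.inter_subset_left).trans (hk b))
    (fun W _ hav => by
      have : W = ∅ := Finset.eq_empty_of_forall_notMem fun v hv => by
        obtain ⟨b, hb⟩ := td.cover_vertex v
        exact hav v hv b (Set.mem_univ _) hb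
      simp [this])
    (by rw [hyA, Finset.sum_add_distrib]; linarith)
  set I₁ := I.filter fun i => ∀ v ∈ (x.fpath i).support, v ∈ S with hI₁
  set I₂ := I.filter fun i => (¬ ∀ v ∈ (x.fpath i).support, v ∈ S) ∧
    ¬ ∀ v ∈ (x.fpath i).support, v ∉ S with hI₂
  set I₃ := I.filter fun i => ∀ v ∈ (x.fpath i).support, v ∉ S with hI₃
  have hpart : ∑ i ∈ I, x.xval i =
      ∑ i ∈ I₁, x.xval i + ∑ i ∈ I₂, x.xval i + ∑ i ∈ I₃, x.xval i := by
    simp only [hI₁, hI₂, hI₃, Finset.sum_filter, ← Finset.sum_add_distrib]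
    refine Finset.sum_congr rfl fun i _ => ?_
    by_cases h1 : ∀ v ∈ (x.fpath i).support, v ∈ S
    · have h2 : ¬ ∀ v ∈ (x.fpath i).support, v ∉ S := fun h =>
        h _ (x.fpath i).start_mem_support (h1 _ (x.fpath i).start_mem_support)
      simp only [if_pos h1, if_neg h2, if_neg (fun h => h.1 h1 : ¬ (¬ _ ∧ ¬ _)), add_zero]
    · by_cases h2 : ∀ v ∈ (x.fpath i).support, v ∉ S
      · simp only [if_neg h1, if_pos h2, if_neg (fun h => h.2 h2 : ¬ (¬ _ ∧ ¬ _)), add_zero,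
          zero_add]
      · simp only [if_neg h1, if_neg h2, if_pos (⟨h1, h2⟩ : _ ∧ _), add_zero, zero_add]
  have hf₂ : ∑ i ∈ I₂, x.xval i ≤ 1 / 8 * ∑ v ∈ S, y v := by
    refine (x.sum_xval_le_cutCard fun i hi => ?_).trans hScut
    obtain ⟨hiI, h1, h2⟩ := Finset.mem_filter.1 hi
    push Not at h1 h2
    obtain ⟨v, hv, hvS⟩ := h1
    obtain ⟨u, hu, huS⟩ := h2
    exact (x.fpath i).exists_crossing_edge (hI i hiI) hu huS hv hvS
  have hyS : ∑ v ∈ S, y v ≤ 2 * ∑ i ∈ I₁, x.xval i + 2 * ∑ i ∈ I₂, x.xval i := by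
    rw [← mul_add, hy, sum_endLoad]
    have h12 : ∑ i ∈ I₁, x.xval i + ∑ i ∈ I₂, x.xval i =
        ∑ i ∈ I, if ∀ v ∈ (x.fpath i).support, v ∉ S then 0 else x.xval i := by
      have h3 : ∑ i ∈ I, x.xval i = ∑ i ∈ I₃, x.xval i +
          ∑ i ∈ I, if ∀ v ∈ (x.fpath i).support, v ∉ S then 0 else x.xval i := by
        rw [hI₃, Finset.sum_filter, ← Finset.sum_add_distrib]
        refine Finset.sum_congr rfl fun i _ => ?_
        split_ifs <;> simp
      linarith
    rw [h12, Finset.mul_sum]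
    refine Finset.sum_le_sum fun i _ => ?_
    have h0 := x.nonneg i
    by_cases h : ∀ v ∈ (x.fpath i).support, v ∉ S
    · simp only [Function.comp, h _ (x.fpath i).start_mem_support,
        h _ (x.fpath i).end_mem_support, if_false]
      (split_ifs; linarith)
    · rw [if_neg h]
      split_ifs <;> linarith
  have hε : (0 : ℝ) < 1 / 8 / 3 ^ (k + 1) := by positivity
  have hε1 : (1 : ℝ) / 8 / 3 ^ (k + 1) ≤ 1 := by
    rw [div_div, div_le_one (by positivity)]
    have : (1 : ℝ) ≤ 3 ^ (k + 1) := one_le_pow₀ (by norm_num)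
    linarith
  obtain ⟨D₁, hD₁, hr₁, hsum₁⟩ := x.exists_routing_of_hub (I := I₁) (S := S) (w := w) hε hε1
    (fun i hi => (Finset.mem_filter.1 hi).2)
    (fun W hW hw => by
      refine le_trans (mul_le_mul_of_nonneg_left ?_ hε.le) (hSlink W hW hw)
      exact Finset.sum_le_sum fun v _ =>
        endLoad_mono (fun i _ => x.nonneg i) (Finset.filter_subset _ _) v)
  set I₄ := I₃.filter fun i => x.dem i ∉ D₁ with hI₄
  obtain ⟨D₂, hD₂, hr₂, hsum₂⟩ := ih (A \ S) (Finset.sdiff_ssubset hSA ⟨w, hwS⟩) I₄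
    (fun i hi v hv => by
      have h1 := Finset.mem_filter.1 (Finset.mem_filter.1 hi).1
      exact Finset.mem_sdiff.2 ⟨hI i h1.1 v hv, h1.2 v hv⟩)
  have hdis : Disjoint D₁ D₂ := Finset.disjoint_left.2 fun d h1 h2 => by
    obtain ⟨i, hi, rfl⟩ := Finset.mem_image.1 (hD₂ h2)
    exact (Finset.mem_filter.1 hi).2 h1
  have hsum₃ : ∑ i ∈ I₃, x.xval i ≤ D₁.card + ∑ i ∈ I₄, x.xval i := by
    rw [← Finset.sum_filter_add_sum_filter_not I₃ (fun i => x.dem i ∈ D₁)]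
    refine add_le_add_left ?_ _
    rw [← Finset.sum_fiberwise_of_maps_to (t := D₁) (g := x.dem)
      fun i hi => (Finset.mem_filter.1 hi).2]
    refine (Finset.sum_le_sum fun d _ => x.sum_xval_le_one _ d).trans ?_
    simp
  refine ⟨D₁ ∪ D₂, Finset.union_subset (hD₁.trans (Finset.image_subset_image
    (Finset.filter_subset _ _))) (hD₂.trans (Finset.image_subset_image
      ((Finset.filter_subset _ _).trans (Finset.filter_subset _ _)))),
    hr₁.union hr₂ hSA Finset.sdiff_subset Finset.disjoint_sdiff, ?_⟩
  rw [Finset.card_union_of_disjoint hdis, Nat.cast_add]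
  have h3k : (1 : ℝ) ≤ 3 ^ k := one_le_pow₀ (by norm_num)
  have hf₁ : ∑ i ∈ I₁, x.xval i ≤ 144 * 3 ^ k * D₁.card := by
    have h : (1 : ℝ) / 8 / 3 ^ (k + 1) * ∑ i ∈ I₁, x.xval i =
        (∑ i ∈ I₁, x.xval i) / (24 * 3 ^ k) := by
      rw [pow_succ]
      field_simp
      ring
    rw [h, div_le_iff₀ (by positivity)] at hsum₁
    linarith
  have hD₁0 : (0 : ℝ) ≤ D₁.card := Nat.cast_nonneg _
  nlinarith

end FracSol

end

/-- **MEDP in bounded-treewidth graphs.** For every integer `k ≥ 1` there is a constant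
`c_k = 216·c·(k+1)·3^k` (for a universal constant `c`) such that, for every graph `G`
of treewidth at most `k` and every MEDP instance on `G`, any fractional solution `x` of
the flow LP admits an integral routing, on edge-disjoint paths (congestion `1`), of at
least `val(x)/c_k` of the demand pairs. -/
theorem medp_bounded_treewidth :
    ∃ c : ℝ, 0 < c ∧
      ∀ (k : ℕ), 1 ≤ k →
      ∀ (V : Type) [Fintype V] [DecidableEq V] (G : SimpleGraph V),
        treewidthLE G k →
        ∀ (n : ℕ) (s t : Fin n → V) (x : FracSol G s t),
          HasIntegralRouting G s t 1
            (x.value / (216 * c * ((k : ℝ) + 1) * 3 ^ k)) := by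
  refine ⟨1, one_pos, fun k _ V _ _ G htw n s t x => ?_⟩
  obtain ⟨td, hk⟩ := htw
  obtain ⟨D, -, hr, hsum⟩ := x.exists_routing td hk Finset.univ Finset.univ
    fun _ _ v _ => Finset.mem_univ v
  refine hr.hasIntegralRouting ?_
  rw [div_le_iff₀ (by positivity)]
  refine le_trans hsum ?_
  have h1 : (193 : ℝ) * 3 ^ k ≤ 216 * 1 * ((k : ℝ) + 1) * 3 ^ k := by
    have : (193 : ℝ) ≤ 216 * 1 * ((k : ℝ) + 1) := by
      have : (0 : ℝ) ≤ k := Nat.cast_nonneg k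
      linarith
    exact mul_le_mul_of_nonneg_right this (by positivity)
  rw [mul_comm (D.card : ℝ)]
  exact mul_le_mul_of_nonneg_right h1 (Nat.cast_nonneg _)
end

section
/- Let (G,H) be a matching instance of MEDP with a feasible fractional LP solution x (with per-pair values x_i), and suppose there is a second flow in G (respecting unit edge capacities) that simultaneously routes at least x_i/α units from each terminal of pair i to some fixed set S ⊆ V, where α ≥ 1. Then there exists an integral routing, on edge-disjoint paths, of at least (1/(36·α·|S|))·Σ_i x_i of the demand pairs. -/
open Finset

/-- `X` is `π`-flow-well-linked in `G`: there is a feasible multicommodity flow in `G`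
(respecting unit edge capacities) routing `π(u)·π(v)/π(X)` between every unordered pair
of distinct `u, v ∈ X`. -/
def FlowWellLinked {V : Type} [DecidableEq V] (G : SimpleGraph V) (X : Finset V)
    (π : V → ℝ) : Prop :=
  ∃ (m : ℕ) (a b : Fin m → V) (P : ∀ i, G.Walk (a i) (b i)) (f : Fin m → ℝ),
    (∀ i, 0 ≤ f i) ∧
    (∀ e : Sym2 V, (∑ i, (ecount (P i).edges e : ℝ) * f i) ≤ 1) ∧
    (∀ u ∈ X, ∀ v ∈ X, u ≠ v →
      (∑ i, if (a i = u ∧ b i = v) ∨ (a i = v ∧ b i = u) then f i else 0)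
        = π u * π v / (∑ w ∈ X, π w))

/-- There is a single-commodity flow in `G` (respecting unit edge capacities) which
simultaneously routes `φ(v)` units from each `v ∈ A`, all flow terminating in `R`. -/
def RoutesToSet {V : Type} [DecidableEq V] (G : SimpleGraph V) (φ : V → ℝ)
    (A R : Finset V) : Prop :=
  ∃ (m : ℕ) (a b : Fin m → V) (P : ∀ i, G.Walk (a i) (b i)) (f : Fin m → ℝ),
    (∀ i, 0 ≤ f i) ∧ (∀ i, a i ∈ A ∧ b i ∈ R) ∧
    (∀ e : Sym2 V, (∑ i, (ecount (P i).edges e : ℝ) * f i) ≤ 1) ∧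
    (∀ v ∈ A, φ v ≤ ∑ i, if a i = v then f i else 0)

section Cuts

variable {V : Type} [DecidableEq V]

/-- The number of ordered pairs in `D` leaving the vertex set `W`. -/
def dcut (D : Finset (V × V)) (W : Finset V) : ℕ :=
  (D.filter fun p => p.1 ∈ W ∧ p.2 ∉ W).card

lemma dcut_eq_sum (D : Finset (V × V)) (W : Finset V) :
    dcut D W = ∑ p ∈ D, if p.1 ∈ W ∧ p.2 ∉ W then 1 else 0 := by
  rw [dcut, Finset.card_filter]

lemma dcut_submodular (D : Finset (V × V)) (A B : Finset V) :
    dcut D (A ∩ B) + dcut D (A ∪ B) ≤ dcut D A + dcut D B := by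
  simp only [dcut_eq_sum, ← Finset.sum_add_distrib]
  refine Finset.sum_le_sum fun p _ => ?_
  by_cases h1 : p.1 ∈ A <;> by_cases h2 : p.1 ∈ B <;> by_cases h3 : p.2 ∈ A <;>
    by_cases h4 : p.2 ∈ B <;> simp [h1, h2, h3, h4]

lemma dcut_submodular_strict {D : Finset (V × V)} {A B : Finset V} {p : V × V} (hp : p ∈ D)
    (h1A : p.1 ∈ A) (h1B : p.1 ∉ B) (h2A : p.2 ∉ A) (h2B : p.2 ∈ B) :
    dcut D (A ∩ B) + dcut D (A ∪ B) + 1 ≤ dcut D A + dcut D B := by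
  have h : (1 : ℕ) = ∑ q ∈ D, if q = p then 1 else 0 := by simp [hp]
  rw [h]
  simp only [dcut_eq_sum, ← Finset.sum_add_distrib]
  refine Finset.sum_le_sum fun q _ => ?_
  by_cases hq : q = p
  · subst hq
    simp [h1A, h1B, h2A, h2B]
  by_cases h1 : q.1 ∈ A <;> by_cases h2 : q.1 ∈ B <;> by_cases h3 : q.2 ∈ A <;>
    by_cases h4 : q.2 ∈ B <;> simp [h1, h2, h3, h4, hq]

/-- A property of finite sets which holds for `∅` and is closed under unions has a
largest set satisfying it. -/
lemma exists_largest_of_union_closed [Fintype V] (P : Finset V → Prop) (h0 : P ∅)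
    (hU : ∀ A B, P A → P B → P (A ∪ B)) : ∃ W, P W ∧ ∀ X, P X → X ⊆ W := by
  classical
  refine ⟨(Finset.univ.filter P).sup id, ?_, fun X hX => ?_⟩
  · refine Finset.sup_induction h0 (fun A hA B hB => hU A B hA hB) ?_
    intro b hb
    simpa using hb
  · exact Finset.le_sup (f := id) (by simpa using hX)

variable {ι : Type} [Fintype ι]

/-- The number of indices whose position lies in `W`. -/
def tokens (pos : ι → V) (W : Finset V) : ℕ := ∑ i, if pos i ∈ W then 1 else 0

lemma tokens_modular (pos : ι → V) (A B : Finset V) :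
    tokens pos (A ∩ B) + tokens pos (A ∪ B) = tokens pos A + tokens pos B := by
  simp only [tokens, ← Finset.sum_add_distrib]
  refine Finset.sum_congr rfl fun i _ => ?_
  by_cases h1 : pos i ∈ A <;> by_cases h2 : pos i ∈ B <;> simp [h1, h2]

/-- If every vertex set avoiding `u` is left by as many pairs of `D` as it contains tokens,
then some token off `u` can be advanced along a pair of `D`. -/
lemma exists_movable [Fintype V] {D : Finset (V × V)} {pos : ι → V} {u : V}
    (hcut : ∀ W, u ∉ W → tokens pos W ≤ dcut D W) {i₀ : ι} (hi₀ : pos i₀ ≠ u) :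
    ∃ b, (pos i₀, b) ∈ D ∧
      ∀ W, u ∉ W → b ∈ W → pos i₀ ∉ W → tokens pos W + 1 ≤ dcut D W := by
  by_contra! hcon
  obtain ⟨W, ⟨huW, htW, hW⟩, hmax⟩ := exists_largest_of_union_closed
    (fun W : Finset V => u ∉ W ∧ pos i₀ ∉ W ∧ dcut D W ≤ tokens pos W)
    (by simp [dcut]) (by
      rintro A B ⟨hA1, hA2, hA3⟩ ⟨hB1, hB2, hB3⟩
      refine ⟨by simp [hA1, hB1], by simp [hA2, hB2], ?_⟩
      have h1 := dcut_submodular D A B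
      have h2 := tokens_modular pos A B
      have h3 := hcut (A ∩ B) (by simp [hA1])
      omega)
  have hu' : u ∉ insert (pos i₀) W := by simp [huW, hi₀.symm]
  have h1 := hcut _ hu'
  have h2 : tokens pos W + 1 ≤ tokens pos (insert (pos i₀) W) := by
    classical
    have h : (1 : ℕ) = ∑ q : ι, if q = i₀ then 1 else 0 := by simp
    rw [h]
    simp only [tokens, ← Finset.sum_add_distrib]
    refine Finset.sum_le_sum fun q _ => ?_
    by_cases hq : q = i₀
    · subst hq
      simp [htW]
    · by_cases hqW : pos q ∈ W <;> simp [hq, hqW]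
  have h3 : dcut D (insert (pos i₀) W) ≤ dcut D W := by
    refine Finset.card_le_card fun p hp => ?_
    simp only [Finset.mem_filter, Finset.mem_insert, not_or] at hp ⊢
    obtain ⟨hpD, hp1 | hp1, hp2, hp3⟩ := hp
    · obtain ⟨X, hX1, hX2, hX3, hX4⟩ := hcon p.2 (by rw [← hp1]; exact hpD)
      exact absurd (hmax X ⟨hX1, hX3, by omega⟩ hX2) hp3
    · exact ⟨hpD, hp1, hp3⟩
  omega

/-- Directed edge version of Menger's theorem: tokens can be moved to `u` along pairwise
disjoint walks when the cut condition holds. -/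
lemma exists_walks_of_dcut [Fintype V] {G : SimpleGraph V} {u : V} (k : ℕ) :
    ∀ (D : Finset (V × V)) (_ : D.card = k) (_ : ∀ p ∈ D, G.Adj p.1 p.2) (pos : ι → V)
      (_ : ∀ W, u ∉ W → tokens pos W ≤ dcut D W),
      ∃ Q : ∀ i, G.Walk (pos i) u, ∀ p : V × V,
        ∑ i, ((Q i).darts.map (·.toProd)).count p ≤ if p ∈ D then 1 else 0 := by
  classical
  induction k with
  | zero =>
    intro D hD _ pos hcut
    have hpos : ∀ i, pos i = u := by
      intro i
      by_contra hi
      obtain ⟨b, hb, _⟩ := exists_movable hcut hi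
      rw [Finset.card_eq_zero] at hD
      simp [hD] at hb
    exact ⟨fun i => (SimpleGraph.Walk.nil : G.Walk u u).copy (hpos i).symm rfl, by simp⟩
  | succ k ih =>
    intro D hD hadj pos hcut
    by_cases hpos : ∀ i, pos i = u
    · exact ⟨fun i => (SimpleGraph.Walk.nil : G.Walk u u).copy (hpos i).symm rfl, by simp⟩
    push Not at hpos
    obtain ⟨i₀, hi₀⟩ := hpos
    obtain ⟨b, hb, hmove⟩ := exists_movable hcut hi₀
    have hmov : ∀ W, tokens (Function.update pos i₀ b) W + (if pos i₀ ∈ W then 1 else 0)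
        = tokens pos W + (if b ∈ W then 1 else 0) := by
      intro W
      simp only [tokens]
      rw [← Finset.add_sum_erase _ _ (Finset.mem_univ i₀),
        ← Finset.add_sum_erase (a := i₀) Finset.univ (fun i => if pos i ∈ W then 1 else 0)
          (Finset.mem_univ i₀)]
      have : ∑ x ∈ Finset.univ.erase i₀, (if Function.update pos i₀ b x ∈ W then 1 else 0)
          = ∑ x ∈ Finset.univ.erase i₀, (if pos x ∈ W then 1 else 0) := by
        refine Finset.sum_congr rfl fun x hx => ?_
        rw [Function.update_of_ne (Finset.ne_of_mem_erase hx)]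
      rw [this, Function.update_self]
      omega
    have hdel : ∀ W, dcut (D.erase (pos i₀, b)) W + (if pos i₀ ∈ W ∧ b ∉ W then 1 else 0)
        = dcut D W := by
      intro W
      simp only [dcut_eq_sum]
      rw [← Finset.sum_erase_add _ _ hb]
    obtain ⟨Q, hQ⟩ := ih (D.erase (pos i₀, b)) (by rw [Finset.card_erase_of_mem hb]; omega)
      (fun p hp => hadj p (Finset.mem_of_mem_erase hp)) (Function.update pos i₀ b) (by
        intro W hW
        have h1 := hmov W
        have h2 := hdel W
        have h3 := hcut W hW
        have h4 := hmove W hW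
        by_cases hx : pos i₀ ∈ W <;> by_cases hy : b ∈ W <;>
          simp [hx, hy] at h1 h2 h4 <;> omega)
    refine ⟨fun i => if h : i = i₀ then
      SimpleGraph.Walk.copy (.cons (hadj _ hb) ((Q i₀).copy (by simp) rfl)) (by rw [h]) rfl
      else (Q i).copy (by rw [Function.update_of_ne h]) rfl, fun p => ?_⟩
    have hp := hQ p
    rw [← Finset.add_sum_erase _ _ (Finset.mem_univ i₀)] at hp ⊢
    have hrest : ∀ F : ι → ℕ, (∀ x, x ≠ i₀ → F x = ((Q x).darts.map (·.toProd)).count p) →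
        ∑ x ∈ Finset.univ.erase i₀, F x
          = ∑ x ∈ Finset.univ.erase i₀, ((Q x).darts.map (·.toProd)).count p := fun F hF =>
      Finset.sum_congr rfl fun x hx => hF x (Finset.ne_of_mem_erase hx)
    rw [hrest _ (fun x hx => by simp [hx])]
    simp only [dite_true, SimpleGraph.Walk.darts_copy, SimpleGraph.Walk.darts_cons,
      List.map_cons, List.count_cons]
    by_cases hpe : p = (pos i₀, b)
    · subst hpe
      rw [if_neg (Finset.notMem_erase _ _)] at hp
      rw [if_pos hb, beq_self_eq_true, if_pos rfl]
      omega
    · have : ((pos i₀, b) == p) = false := by simpa using fun h => hpe h.symm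
      simp [hpe, this] at hp ⊢
      omega

lemma ecount_eq_count {α : Type} [DecidableEq α] (l : List α) (e : α) :
    ecount l e = l.count e := by
  unfold ecount
  congr!

lemma ecount_edges_le {G : SimpleGraph V} {v w : V} (Q : G.Walk v w) (a b : V) :
    ecount Q.edges s(a, b) ≤ (Q.darts.map (·.toProd)).count (a, b)
      + (Q.darts.map (·.toProd)).count (b, a) := by
  rw [ecount_eq_count]
  induction Q with
  | nil => simp
  | @cons x y z h p ih =>
    simp only [SimpleGraph.Walk.edges_cons, SimpleGraph.Walk.darts_cons, List.map_cons,
      List.count_cons, beq_iff_eq, Sym2.eq_iff, Prod.mk.injEq]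
    split_ifs <;> first | omega | tauto

/-- The ordered pairs of adjacent vertices. -/
noncomputable def adjPairs [Fintype V] (G : SimpleGraph V) : Finset (V × V) :=
  letI := Classical.decPred fun p : V × V => G.Adj p.1 p.2
  Finset.univ.filter fun p => G.Adj p.1 p.2

omit [DecidableEq V] in
lemma mem_adjPairs [Fintype V] {G : SimpleGraph V} {p : V × V} :
    p ∈ adjPairs G ↔ G.Adj p.1 p.2 := by
  simp [adjPairs]

/-- Undirected edge version of Menger's theorem: the cut condition yields pairwise
edge-disjoint walks from all tokens to `u`. -/
lemma exists_edgeDisjoint_walks [Fintype V] {G : SimpleGraph V} {u : V} (pos : ι → V)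
    (hcut : ∀ W, u ∉ W → tokens pos W ≤ dcut (adjPairs G) W) :
    ∃ Q : ∀ i, G.Walk (pos i) u, ∀ e : Sym2 V, ∑ i, ecount (Q i).edges e ≤ 1 := by
  classical
  obtain ⟨D, hDle, hDmin⟩ := Finset.exists_le_minimal
    (Finset.univ.filter fun D : Finset (V × V) =>
      D ⊆ adjPairs G ∧ ∀ W, u ∉ W → tokens pos W ≤ dcut D W)
    (a := adjPairs G) (by simpa using hcut)
  have hD := hDmin.prop
  simp only [Finset.mem_filter, Finset.mem_univ, true_and] at hD
  obtain ⟨hDG, hDcut⟩ := hD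
  have htight : ∀ p ∈ D, ∃ W, u ∉ W ∧ p.1 ∈ W ∧ p.2 ∉ W ∧ dcut D W ≤ tokens pos W := by
    intro p hp
    have hnot : ¬ ∀ W, u ∉ W → tokens pos W ≤ dcut (D.erase p) W := by
      intro h
      have := hDmin.le_of_le (y := D.erase p)
        (by simpa using ⟨(Finset.erase_subset _ _).trans hDG, h⟩) (Finset.erase_subset _ _)
      exact Finset.notMem_erase p D (this hp)
    push Not at hnot
    obtain ⟨W, hW, hlt⟩ := hnot
    have hdel : dcut (D.erase p) W + (if p.1 ∈ W ∧ p.2 ∉ W then 1 else 0) = dcut D W := by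
      simp only [dcut_eq_sum]
      rw [← Finset.sum_erase_add _ _ hp]
    have h3 := hDcut W hW
    by_cases hc : p.1 ∈ W ∧ p.2 ∉ W
    · exact ⟨W, hW, hc.1, hc.2, by simp [hc] at hdel; omega⟩
    · simp only [hc, if_false] at hdel
      omega
  have hanti : ∀ a b, (a, b) ∈ D → (b, a) ∈ D → False := by
    intro a b hab hba
    obtain ⟨A, hA1, hA2, hA3, hA4⟩ := htight _ hab
    obtain ⟨B, hB1, hB2, hB3, hB4⟩ := htight _ hba
    have h1 := dcut_submodular_strict hab hA2 hB3 hA3 hB2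
    have h2 := tokens_modular pos A B
    have h3 := hDcut (A ∩ B) (by simp [hA1])
    have h4 := hDcut (A ∪ B) (by simp [hA1, hB1])
    omega
  obtain ⟨Q, hQ⟩ := exists_walks_of_dcut (G := G) (u := u) D.card D rfl
    (fun p hp => mem_adjPairs.1 (hDG hp)) pos hDcut
  refine ⟨Q, fun e => ?_⟩
  induction e using Sym2.ind with
  | _ a b =>
    calc ∑ i, ecount (Q i).edges s(a, b)
        ≤ ∑ i, (((Q i).darts.map (·.toProd)).count (a, b)
          + ((Q i).darts.map (·.toProd)).count (b, a)) :=
          Finset.sum_le_sum fun i _ => ecount_edges_le (Q i) a b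
      _ ≤ (if (a, b) ∈ D then 1 else 0) + (if (b, a) ∈ D then 1 else 0) := by
          rw [Finset.sum_add_distrib]
          exact add_le_add (hQ _) (hQ _)
      _ ≤ 1 := by
          have := hanti a b
          split_ifs <;> first | omega | tauto

end Cuts

section Symmetric

variable {V : Type} [DecidableEq V] [Fintype V] (G : SimpleGraph V)

/-- The number of adjacent ordered pairs leading from `A` to `B`. -/
noncomputable def between (A B : Finset V) : ℕ :=
  ((adjPairs G).filter fun p => p.1 ∈ A ∧ p.2 ∈ B).card

lemma between_comm (A B : Finset V) : between G A B = between G B A := by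
  refine Finset.card_bij' (fun p _ => p.swap) (fun p _ => p.swap) ?_ ?_ ?_ ?_ <;>
    simp +contextual [mem_adjPairs, SimpleGraph.adj_comm]

lemma between_eq_sum (A B : Finset V) :
    between G A B = ∑ p ∈ adjPairs G, if p.1 ∈ A ∧ p.2 ∈ B then 1 else 0 := by
  rw [between, Finset.card_filter]

lemma dcut_adjPairs_compl (A : Finset V) : dcut (adjPairs G) Aᶜ = dcut (adjPairs G) A := by
  have h1 := between_comm G A Aᶜ
  simp only [between, Finset.mem_compl] at h1
  simp only [dcut, Finset.mem_compl, not_not]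
  exact h1.symm

lemma dcut_posimodular (A B : Finset V) :
    dcut (adjPairs G) (A \ B) + dcut (adjPairs G) (B \ A)
      ≤ dcut (adjPairs G) A + dcut (adjPairs G) B := by
  have h := dcut_submodular (adjPairs G) A Bᶜ
  rw [dcut_adjPairs_compl, ← dcut_adjPairs_compl G (A ∪ Bᶜ), ← Finset.sdiff_eq_inter_compl,
    Finset.compl_union, compl_compl, Finset.inter_comm, ← Finset.sdiff_eq_inter_compl] at h
  exact h

lemma dcut_sdiff_of_subset {A B : Finset V} (h : A ⊆ B) :
    dcut (adjPairs G) (B \ A) + dcut (adjPairs G) A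
      = dcut (adjPairs G) B + 2 * between G A (B \ A) := by
  have h1 : dcut (adjPairs G) (B \ A) + dcut (adjPairs G) A
      = dcut (adjPairs G) B + between G A (B \ A) + between G (B \ A) A := by
    simp only [dcut_eq_sum, between_eq_sum, ← Finset.sum_add_distrib]
    refine Finset.sum_congr rfl fun p _ => ?_
    have a1 : p.1 ∈ A → p.1 ∈ B := fun h' => h h'
    have a2 : p.2 ∈ A → p.2 ∈ B := fun h' => h h'
    by_cases h1 : p.1 ∈ A <;> by_cases h2 : p.1 ∈ B <;> by_cases h3 : p.2 ∈ A <;>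
      by_cases h4 : p.2 ∈ B <;> simp_all
  rw [h1, between_comm G (B \ A) A]
  ring

omit [Fintype V] in
lemma dcut_add_dcut_sdiff_le {D : Finset (V × V)} {C W : Finset V} (hCW : C ⊆ W)
    (h₁ : ∀ p ∈ D, p.1 ∈ C → p.2 ∈ W → p.2 ∈ C) (h₂ : ∀ p ∈ D, p.2 ∈ C → p.1 ∈ W → p.1 ∈ C) :
    dcut D C + dcut D (W \ C) ≤ dcut D W := by
  simp only [dcut_eq_sum, ← Finset.sum_add_distrib]
  refine Finset.sum_le_sum fun p hp => ?_
  have a1 := h₁ p hp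
  have a2 := h₂ p hp
  have a3 : p.1 ∈ C → p.1 ∈ W := fun h => hCW h
  have a4 : p.2 ∈ C → p.2 ∈ W := fun h => hCW h
  clear h₁ h₂ hCW hp
  simp only [Finset.mem_sdiff]
  by_cases k1 : p.1 ∈ C <;> by_cases k2 : p.1 ∈ W <;> by_cases k3 : p.2 ∈ C <;>
    by_cases k4 : p.2 ∈ W <;> simp_all

/-- If every set containing `a` or `b` and avoiding `u` has a nonempty cut, then `a` and `b`
are joined inside any set avoiding `u` whose cut has at most one edge. -/
lemma exists_path_within {a b u : V} {W : Finset V} (hu : u ∉ W) (ha : a ∈ W) (hb : b ∈ W)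
    (hW : dcut (adjPairs G) W ≤ 1)
    (hcut : ∀ X, u ∉ X → a ∈ X ∨ b ∈ X → 1 ≤ dcut (adjPairs G) X) :
    ∃ Q : G.Walk a b, Q.IsPath ∧ ∀ v ∈ Q.support, v ∈ W := by
  classical
  suffices h : ∃ Q : G.Walk a b, ∀ v ∈ Q.support, v ∈ W by
    obtain ⟨Q, hQ⟩ := h
    exact ⟨Q.bypass, Q.bypass_isPath, fun v hv => hQ v (Q.support_bypass_subset_support hv)⟩
  by_contra hno
  set C : Finset V := Finset.univ.filter fun v => ∃ Q : G.Walk a v, ∀ w ∈ Q.support, w ∈ W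
    with hC
  have hCW : C ⊆ W := by
    intro v hv
    simp only [hC, Finset.mem_filter, Finset.mem_univ, true_and] at hv
    obtain ⟨Q, hQ⟩ := hv
    exact hQ v Q.end_mem_support
  have haC : a ∈ C := by
    simp only [hC, Finset.mem_filter, Finset.mem_univ, true_and]
    exact ⟨.nil, by simpa using ha⟩
  have hbC : b ∉ C := by simpa [hC] using hno
  have hstep : ∀ v w, G.Adj v w → v ∈ C → w ∈ W → w ∈ C := by
    intro v w hvw hv hw
    simp only [hC, Finset.mem_filter, Finset.mem_univ, true_and] at hv ⊢
    obtain ⟨Q, hQ⟩ := hv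
    refine ⟨Q.concat hvw, fun x hx => ?_⟩
    rw [SimpleGraph.Walk.support_concat] at hx
    simp only [List.mem_append, List.mem_singleton] at hx
    rcases hx with hx | rfl
    · exact hQ x hx
    · exact hw
  have hsum : dcut (adjPairs G) C + dcut (adjPairs G) (W \ C) ≤ dcut (adjPairs G) W := 
    dcut_add_dcut_sdiff_le hCW (fun p hp => hstep _ _ (mem_adjPairs.1 hp))
      (fun p hp => hstep _ _ (mem_adjPairs.1 hp).symm)
  have h1 := hcut C (fun h => hu (hCW h)) (Or.inl haC)
  have h2 := hcut (W \ C) (by simp [hu]) (Or.inr (by simp [hb, hbC]))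
  omega

end Symmetric

section Demands

variable {V : Type} [DecidableEq V] {n : ℕ} (s t : Fin n → V)

/-- The total weight of the terminals inside `W`, where both endpoints of `j ∈ A` have
weight `f j`. -/
def load (A : Finset (Fin n)) (f : Fin n → ℝ) (W : Finset V) : ℝ :=
  ∑ j ∈ A, f j * ((if s j ∈ W then 1 else 0) + (if t j ∈ W then 1 else 0))

/-- The number of terminals inside `W` of the demands in `I`. -/
def ends (I : Finset (Fin n)) (W : Finset V) : ℕ :=
  ∑ j ∈ I, ((if s j ∈ W then 1 else 0) + (if t j ∈ W then 1 else 0))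

lemma ends_modular (I : Finset (Fin n)) (A B : Finset V) :
    ends s t I (A ∩ B) + ends s t I (A ∪ B) = ends s t I A + ends s t I B := by
  simp only [ends, ← Finset.sum_add_distrib]
  refine Finset.sum_congr rfl fun i _ => ?_
  by_cases h1 : s i ∈ A <;> by_cases h2 : s i ∈ B <;> by_cases h3 : t i ∈ A <;>
    by_cases h4 : t i ∈ B <;> simp [h1, h2, h3, h4]

lemma ends_sdiff_of_subset (I : Finset (Fin n)) {A B : Finset V} (h : A ⊆ B) :
    ends s t I (B \ A) + ends s t I A = ends s t I B := by
  have := ends_modular s t I (B \ A) A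
  rw [Finset.sdiff_inter_self, Finset.sdiff_union_of_subset h] at this
  simpa [ends] using this.symm

lemma ends_le (I : Finset (Fin n)) (W : Finset V) : ends s t I W ≤ 2 * I.card := by
  unfold ends
  rw [mul_comm, ← smul_eq_mul, ← Finset.sum_const]
  refine Finset.sum_le_sum fun j _ => ?_
  split_ifs <;> omega

variable {s t}

lemma load_mono {A B : Finset (Fin n)} {f : Fin n → ℝ} (hAB : A ⊆ B)
    (hf : ∀ j ∈ B, 0 ≤ f j) (W : Finset V) : load s t A f W ≤ load s t B f W := by
  refine Finset.sum_le_sum_of_subset_of_nonneg hAB fun j hj _ => ?_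
  exact mul_nonneg (hf j hj) (by split_ifs <;> norm_num)

variable [Fintype V] {G : SimpleGraph V} {u : V} {f : Fin n → ℝ}

lemma one_le_dcut_of_load {A : Finset (Fin n)} (hf : ∀ j ∈ A, 0 < f j)
    (hcut : ∀ W, u ∉ W → load s t A f W ≤ dcut (adjPairs G) W) {j : Fin n} (hj : j ∈ A)
    {W : Finset V} (hu : u ∉ W) (hW : s j ∈ W ∨ t j ∈ W) : 1 ≤ dcut (adjPairs G) W := by
  have h1 : 0 < load s t A f W := by
    refine Finset.sum_pos' (fun i hi => mul_nonneg (hf i hi).le (by split_ifs <;> norm_num))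
      ⟨j, hj, mul_pos (hf j hj) ?_⟩
    rcases hW with h | h <;> simp only [h, if_true] <;> split_ifs <;> norm_num
  have h2 := h1.trans_le (hcut W hu)
  exact_mod_cast h2

/-- If each demand of `A` lies in a set avoiding `u` with at most one cut edge, then many of
these demands can be placed in pairwise disjoint such sets. -/
lemma exists_disjoint_bridge_sets (A : Finset (Fin n)) :
    ∀ (U : Finset V) (_ : ∀ j ∈ A, 0 < f j)
      (_ : ∀ W, u ∉ W → load s t A f W ≤ dcut (adjPairs G) W)
      (_ : ∀ j ∈ A, ∃ W ⊆ U, u ∉ W ∧ s j ∈ W ∧ t j ∈ W ∧ dcut (adjPairs G) W ≤ 1),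
    ∃ J ⊆ A, ∃ W : Fin n → Finset V,
      (∀ j ∈ J, W j ⊆ U ∧ u ∉ W j ∧ s j ∈ W j ∧ t j ∈ W j ∧ dcut (adjPairs G) (W j) ≤ 1) ∧
      (∀ i ∈ J, ∀ j ∈ J, i ≠ j → Disjoint (W i) (W j)) ∧ ∑ j ∈ A, f j ≤ J.card := by
  induction A using Finset.strongInduction with
  | H A ih =>
    intro U hf hcut hA
    rcases A.eq_empty_or_nonempty with rfl | ⟨j₁, hj₁⟩
    · exact ⟨∅, by simp, fun _ => ∅, by simp, by simp, by simp⟩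
    obtain ⟨M, hM, hMmax⟩ := Finset.exists_max_image
      (Finset.univ.filter fun X : Finset V => X ⊆ U ∧ u ∉ X ∧ dcut (adjPairs G) X ≤ 1 ∧
        ∃ j ∈ A, s j ∈ X ∧ t j ∈ X) Finset.card (by
          obtain ⟨W, h1, h2, h3, h4, h5⟩ := hA j₁ hj₁
          exact ⟨W, by simpa using ⟨h1, h2, h5, j₁, hj₁, h3, h4⟩⟩)
    simp only [Finset.mem_filter, Finset.mem_univ, true_and] at hM hMmax
    obtain ⟨hMU, huM, hMcut, j₀, hj₀, hsM, htM⟩ := hM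
    set A' := A.filter fun j => s j ∉ M ∧ t j ∉ M with hA'
    have hA'A : A' ⊆ A := Finset.filter_subset _ _
    have hA'ss : A' ⊂ A := by
      refine Finset.ssubset_iff_subset_ne.2 ⟨hA'A, fun h => ?_⟩
      rw [← h] at hj₀
      simp [hA', hsM] at hj₀
    have hpos : ∀ j ∈ A, ∀ X : Finset V, u ∉ X → s j ∈ X ∨ t j ∈ X →
        1 ≤ dcut (adjPairs G) X := fun j hj X hX h => one_le_dcut_of_load hf hcut hj hX h
    obtain ⟨J, hJA, W, hW, hdisj, hsum⟩ := ih A' hA'ss (U \ M) (fun j hj => hf j (hA'A hj))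
      (fun X hX => (load_mono hA'A (fun j hj => (hf j hj).le) X).trans (hcut X hX)) (by
        intro k hk
        simp only [hA', Finset.mem_filter] at hk
        obtain ⟨hkA, hks, hkt⟩ := hk
        obtain ⟨X, hXU, huX, hsX, htX, hXcut⟩ := hA k hkA
        refine ⟨X \ M, Finset.sdiff_subset_sdiff hXU subset_rfl, by simp [huX],
          by simp [hsX, hks], by simp [htX, hkt], ?_⟩
        by_cases hmeet : ∃ j ∈ A, s j ∈ X ∩ M ∨ t j ∈ X ∩ M
        · exfalso
          obtain ⟨j, hj, hjX⟩ := hmeet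
          have h1 := hpos j hj (X ∩ M) (by simp [huX]) hjX
          have h2 := dcut_submodular (adjPairs G) X M
          have h3 := hMmax (X ∪ M) ⟨Finset.union_subset hXU hMU, by simp [huX, huM], by omega,
            k, hkA, by simp [hsX], by simp [htX]⟩
          have h4 := Finset.eq_of_subset_of_card_le (Finset.subset_union_right (s₁ := X)) h3
          exact hks (h4 ▸ Finset.mem_union_left _ hsX)
        · push Not at hmeet
          have h1 := hpos j₀ hj₀ (M \ X) (by simp [huM])
            (Or.inl (Finset.mem_sdiff.2 ⟨hsM, fun h => (hmeet j₀ hj₀).1 (by simp [h, hsM])⟩))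
          have h2 := dcut_posimodular G X M
          omega)
    have hj₀J : j₀ ∉ J := fun h => by
      have := hJA h
      simp [hA', hsM] at this
    have hne : ∀ j ∈ J, j ≠ j₀ := fun j hj h => hj₀J (h ▸ hj)
    refine ⟨insert j₀ J, Finset.insert_subset hj₀ (hJA.trans hA'A),
      Function.update W j₀ M, ?_, ?_, ?_⟩
    · intro j hj
      rcases Finset.mem_insert.1 hj with rfl | hj
      · simpa using ⟨hMU, huM, hsM, htM, hMcut⟩
      · rw [Function.update_of_ne (hne j hj)]
        exact ⟨(hW j hj).1.trans Finset.sdiff_subset, (hW j hj).2⟩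
    · have hdM : ∀ j ∈ J, Disjoint M (W j) := fun j hj =>
        (Finset.disjoint_of_subset_left (hW j hj).1 Finset.sdiff_disjoint).symm
      intro i hi j hj hij
      rcases Finset.mem_insert.1 hi with hi' | hi' <;>
        rcases Finset.mem_insert.1 hj with hj' | hj'
      · exact absurd (hi'.trans hj'.symm) hij
      · rw [hi', Function.update_self, Function.update_of_ne (hne j hj')]
        exact hdM j hj'
      · rw [hj', Function.update_self, Function.update_of_ne (hne i hi')]
        exact (hdM i hi').symm
      · rw [Function.update_of_ne (hne i hi'), Function.update_of_ne (hne j hj')]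
        exact hdisj i hi' j hj' hij
    · rw [Finset.card_insert_of_notMem hj₀J, ← Finset.sum_filter_add_sum_filter_not A
        (fun j => s j ∉ M ∧ t j ∉ M)]
      have h1 : ∑ j ∈ A with ¬(s j ∉ M ∧ t j ∉ M), f j ≤ load s t A f M := by
        rw [Finset.sum_filter]
        refine Finset.sum_le_sum fun j hj => ?_
        have := hf j hj
        by_cases h1 : s j ∈ M <;> by_cases h2 : t j ∈ M <;> simp [h1, h2]
        linarith
      have h2 := hcut M huM
      have h3 : (dcut (adjPairs G) M : ℝ) ≤ 1 := by exact_mod_cast hMcut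
      push_cast
      linarith

omit [Fintype V] in
lemma ecount_le_one_of_isPath {a b : V} {Q : G.Walk a b} (hQ : Q.IsPath) (e : Sym2 V) :
    ecount Q.edges e ≤ 1 := by
  rw [ecount_eq_count]
  exact List.nodup_iff_count_le_one.1 hQ.isTrail.edges_nodup e

lemma hasIntegralRouting_of_bridge_sets {A : Finset (Fin n)} (hf : ∀ j ∈ A, 0 < f j)
    (hcut : ∀ W, u ∉ W → load s t A f W ≤ dcut (adjPairs G) W)
    (hA : ∀ j ∈ A, ∃ W, u ∉ W ∧ s j ∈ W ∧ t j ∈ W ∧ dcut (adjPairs G) W ≤ 1) :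
    HasIntegralRouting G s t 1 (∑ j ∈ A, f j) := by
  obtain ⟨J, hJA, W, hW, hdisj, hsum⟩ := exists_disjoint_bridge_sets (G := G) (u := u) A
    Finset.univ hf hcut (by simpa using hA)
  have hpath : ∀ j ∈ J, ∃ Q : G.Walk (s j) (t j), Q.IsPath ∧ ∀ v ∈ Q.support, v ∈ W j := by
    intro j hj
    obtain ⟨-, h1, h2, h3, h4⟩ := hW j hj
    exact exists_path_within G h1 h2 h3 h4 fun X hX h =>
      one_le_dcut_of_load hf hcut (hJA hj) hX h
  choose Q hQ hQW using hpath
  refine ⟨J, Q, hsum, fun e => ?_⟩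
  by_cases hex : ∃ j : {j // j ∈ J}, ecount (Q j.1 j.2).edges e ≠ 0
  · obtain ⟨j, hj⟩ := hex
    rw [Finset.sum_eq_single j]
    · exact ecount_le_one_of_isPath (hQ _ _) e
    · intro k _ hkj
      by_contra hk
      rw [ecount_eq_count] at hj hk
      replace hj := List.count_pos_iff.1 (Nat.pos_of_ne_zero hj)
      replace hk := List.count_pos_iff.1 (Nat.pos_of_ne_zero hk)
      induction e using Sym2.ind with
      | _ a b =>
        have h1 := hQW _ _ _ ((Q j.1 j.2).fst_mem_support_of_mem_edges hj)
        have h2 := hQW _ _ _ ((Q k.1 k.2).fst_mem_support_of_mem_edges hk)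
        exact Finset.disjoint_left.1
          (hdisj _ j.2 _ k.2 fun h => hkj (Subtype.ext h).symm) h1 h2
    · simp
  · push Not at hex
    rw [Finset.sum_eq_zero fun j _ => hex j]
    exact Nat.zero_le _

/-- Demands whose terminals satisfy the cut condition can all be routed through `u`. -/
lemma hasIntegralRouting_of_ends_le {I : Finset (Fin n)}
    (hI : ∀ W, u ∉ W → ends s t I W ≤ dcut (adjPairs G) W) :
    HasIntegralRouting G s t 1 I.card := by
  obtain ⟨Q, hQ⟩ := exists_edgeDisjoint_walks (G := G) (u := u)
    (fun p : {j // j ∈ I} × Bool => if p.2 then s p.1 else t p.1) (by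
      intro W hW
      convert hI W hW using 1
      rw [tokens, Fintype.sum_prod_type]
      simp only [Fintype.sum_bool, if_true, Bool.false_eq_true, if_false]
      rw [ends]
      exact (Finset.sum_coe_sort I fun j =>
        (if s j ∈ W then 1 else 0) + (if t j ∈ W then 1 else 0)))
  refine ⟨I, fun j hj => ((Q (⟨j, hj⟩, true)).copy (by simp) rfl).append
    ((Q (⟨j, hj⟩, false)).copy (by simp) rfl).reverse, le_rfl, fun e => ?_⟩
  refine le_trans (le_of_eq ?_) (hQ e)
  rw [Fintype.sum_prod_type, Finset.univ_eq_attach]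
  refine Finset.sum_congr rfl fun j _ => ?_
  simp [ecount_eq_count, SimpleGraph.Walk.edges_append]

/-- If no demand of `A` is separated from `u` by a single edge, a constant fraction of the
weight of `A` can be linked to `u` in the sense of the cut condition. -/
lemma exists_linked_of_no_bridge {A : Finset (Fin n)} (hf : ∀ j ∈ A, 0 < f j)
    (hf1 : ∀ j ∈ A, f j ≤ 1)
    (hcut : ∀ W, u ∉ W → load s t A f W ≤ dcut (adjPairs G) W)
    (hA : ∀ j ∈ A, ∀ W, u ∉ W → s j ∈ W → t j ∈ W → 2 ≤ dcut (adjPairs G) W) :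
    ∃ I : Finset (Fin n), (∀ W, u ∉ W → ends s t I W ≤ dcut (adjPairs G) W) ∧
      ∑ j ∈ A, f j ≤ 9 * I.card := by
  classical
  obtain ⟨I, -, hImax⟩ := Finset.exists_le_maximal
    (A.powerset.filter fun I => ∀ W, u ∉ W → ends s t I W ≤ dcut (adjPairs G) W)
    (a := ∅) (Finset.mem_filter.2 ⟨Finset.empty_mem_powerset _, fun W _ => by simp [ends]⟩)
  have hI := hImax.prop
  simp only [Finset.mem_filter, Finset.mem_powerset] at hI
  obtain ⟨hIA, hIcut⟩ := hI
  refine ⟨I, hIcut, ?_⟩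
  obtain ⟨W₀, ⟨huW₀, hW₀⟩, hW₀max⟩ := exists_largest_of_union_closed
    (fun W : Finset V => u ∉ W ∧ dcut (adjPairs G) W ≤ ends s t I W)
    (by simp [dcut]) (by
      rintro X Y ⟨hX1, hX2⟩ ⟨hY1, hY2⟩
      refine ⟨by simp [hX1, hY1], ?_⟩
      have h1 := dcut_submodular (adjPairs G) X Y
      have h2 := ends_modular s t I X Y
      have h3 := hIcut (X ∩ Y) (by simp [hX1])
      omega)
  set F : Finset (Finset V) := Finset.univ.filter fun X =>
    W₀ ⊆ X ∧ u ∉ X ∧ dcut (adjPairs G) X ≤ ends s t I X + 1 with hF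
  set M : Finset (Finset V) := F.filter fun X =>
    (∀ Y ∈ F, X ⊆ Y → Y ⊆ X) ∧ ∃ j ∈ A, s j ∈ X \ W₀ ∧ t j ∈ X \ W₀ with hM
  have hMF : ∀ X ∈ M, W₀ ⊆ X ∧ u ∉ X ∧ dcut (adjPairs G) X ≤ ends s t I X + 1 := by
    intro X hX
    simpa [hF] using (Finset.mem_filter.1 hX).1
  have hpair : ∀ X ∈ M, ∀ Y ∈ M, X ≠ Y → X ∩ Y ⊆ W₀ := by
    intro X hX Y hY hXY
    obtain ⟨a1, a2, a3⟩ := hMF X hX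
    obtain ⟨b1, b2, b3⟩ := hMF Y hY
    have c1 := dcut_submodular (adjPairs G) X Y
    have c2 := ends_modular s t I X Y
    by_cases hU : dcut (adjPairs G) (X ∪ Y) ≤ ends s t I (X ∪ Y) + 1
    · exfalso
      have hUF : X ∪ Y ∈ F := by
        simpa [hF] using ⟨a1.trans Finset.subset_union_left, ⟨a2, b2⟩, hU⟩
      have d1 := (Finset.mem_filter.1 hX).2.1 _ hUF Finset.subset_union_left
      have d2 := (Finset.mem_filter.1 hY).2.1 _ hUF Finset.subset_union_right
      exact hXY (Finset.Subset.antisymm (Finset.subset_union_left.trans d2)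
        (Finset.subset_union_right.trans d1))
    · exact hW₀max _ ⟨by simp [a2], by omega⟩
  have hmult : ∀ v, (∑ X ∈ M, if v ∈ X \ W₀ then 1 else 0) ≤ if v ∉ W₀ then 1 else 0 := by
    intro v
    rw [← Finset.card_filter]
    by_cases hv : v ∈ W₀
    · simp [hv]
    · simp only [hv, not_false_eq_true, if_true]
      refine Finset.card_le_one.2 fun X hX Y hY => ?_
      simp only [Finset.mem_filter, Finset.mem_sdiff] at hX hY
      by_contra hXY
      exact hv (hpair X hX.1 Y hY.1 hXY (Finset.mem_inter.2 ⟨hX.2.1, hY.2.1⟩))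
  have hlocal : ∀ X ∈ M, dcut (adjPairs G) (X \ W₀)
      ≤ 3 * (between G W₀ (X \ W₀) + ends s t I (X \ W₀)) := by
    intro X hX
    obtain ⟨a1, a2, a3⟩ := hMF X hX
    obtain ⟨j, hj, hjs, hjt⟩ := (Finset.mem_filter.1 hX).2.2
    have c1 := hA j hj (X \ W₀) (by simp [a2]) hjs hjt
    have c2 := dcut_sdiff_of_subset G a1
    have c3 := ends_sdiff_of_subset s t I a1
    have c4 := hIcut W₀ huW₀
    omega
  have hbetween : ∑ X ∈ M, between G W₀ (X \ W₀) ≤ dcut (adjPairs G) W₀ := by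
    simp only [between_eq_sum, dcut_eq_sum]
    rw [Finset.sum_comm]
    refine Finset.sum_le_sum fun p _ => ?_
    have := hmult p.2
    by_cases hp : p.1 ∈ W₀
    · simpa only [hp, true_and] using this
    · simp [hp]
  have hends : ∑ X ∈ M, ends s t I (X \ W₀) + ends s t I W₀ ≤ 2 * I.card := by
    simp only [ends]
    rw [Finset.sum_comm, ← Finset.sum_add_distrib, mul_comm, ← smul_eq_mul, ← Finset.sum_const]
    refine Finset.sum_le_sum fun j _ => ?_
    rw [Finset.sum_add_distrib]
    have h1 := hmult (s j)
    have h2 := hmult (t j)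
    by_cases k1 : s j ∈ W₀ <;> by_cases k2 : t j ∈ W₀ <;>
      simp only [k1, k2, not_true_eq_false, not_false_eq_true, if_true, if_false] at h1 h2 ⊢ <;>
      omega
  have hloc : ∑ X ∈ M, dcut (adjPairs G) (X \ W₀) ≤ 6 * I.card := by
    have := Finset.sum_le_sum hlocal
    rw [← Finset.mul_sum, Finset.sum_add_distrib] at this
    omega
  have hcover : ∀ j ∈ A, j ∈ I ∨ (s j ∈ W₀ ∨ t j ∈ W₀) ∨ ∃ X ∈ M, s j ∈ X \ W₀ := by
    intro j hj
    by_cases hjI : j ∈ I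
    · exact Or.inl hjI
    by_cases hj0 : s j ∈ W₀ ∨ t j ∈ W₀
    · exact Or.inr (Or.inl hj0)
    refine Or.inr (Or.inr ?_)
    push Not at hj0
    have hnot : ¬ ∀ W, u ∉ W → ends s t (insert j I) W ≤ dcut (adjPairs G) W := by
      intro h
      have := hImax.le_of_ge (y := insert j I)
        (by simpa using ⟨Finset.insert_subset hj hIA, h⟩) (Finset.subset_insert _ _)
      exact hjI (this (Finset.mem_insert_self _ _))
    push Not at hnot
    obtain ⟨W, huW, hW⟩ := hnot
    have hsplit : ends s t (insert j I) W =
        (if s j ∈ W then 1 else 0) + (if t j ∈ W then 1 else 0) + ends s t I W := by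
      simp only [ends]
      rw [Finset.sum_insert hjI]
    have hle := hIcut W huW
    have hntight : ¬ dcut (adjPairs G) W ≤ ends s t I W := by
      intro h
      have hsub := hW₀max W ⟨huW, h⟩
      have h1 : s j ∉ W := fun h' => hj0.1 (hsub h')
      have h2 : t j ∉ W := fun h' => hj0.2 (hsub h')
      simp only [h1, h2, if_false] at hsplit
      omega
    have hboth : s j ∈ W ∧ t j ∈ W := by
      by_contra hcon
      by_cases h1 : s j ∈ W <;> by_cases h2 : t j ∈ W <;>
        simp only [h1, h2, if_true, if_false] at hsplit <;> first | omega | tauto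
    simp only [hboth.1, hboth.2, if_true] at hsplit
    have c1 := dcut_submodular (adjPairs G) W W₀
    have c2 := ends_modular s t I W W₀
    have c3 := hIcut (W ∩ W₀) (by simp [huW])
    obtain ⟨X, hWX, hX⟩ := Finset.exists_le_maximal F (a := W ∪ W₀) (by
      simp only [hF, Finset.mem_filter, Finset.mem_univ, true_and]
      exact ⟨Finset.subset_union_right, by simp [huW, huW₀], by omega⟩)
    have hsX : s j ∈ X \ W₀ :=
      Finset.mem_sdiff.2 ⟨hWX (Finset.mem_union_left _ hboth.1), hj0.1⟩
    have htX : t j ∈ X \ W₀ :=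
      Finset.mem_sdiff.2 ⟨hWX (Finset.mem_union_left _ hboth.2), hj0.2⟩
    exact ⟨X, Finset.mem_filter.2 ⟨hX.prop, fun Y hY hXY => hX.le_of_ge hY hXY,
      j, hj, hsX, htX⟩, hsX⟩
  have hbound : ∀ j ∈ A, f j ≤ (if j ∈ I then 1 else 0)
      + f j * ((if s j ∈ W₀ then 1 else 0) + (if t j ∈ W₀ then 1 else 0))
      + ∑ X ∈ M, f j * ((if s j ∈ X \ W₀ then 1 else 0) + (if t j ∈ X \ W₀ then 1 else 0)) := by
    intro j hj
    have hfj := hf j hj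
    have e0 : (0 : ℝ) ≤ if j ∈ I then 1 else 0 := by split_ifs <;> norm_num
    have e1 : ∀ X : Finset V,
        0 ≤ f j * ((if s j ∈ X then 1 else 0) + (if t j ∈ X then 1 else 0)) := fun X =>
      mul_nonneg hfj.le (by split_ifs <;> norm_num)
    have e2 : ∀ X : Finset V, s j ∈ X ∨ t j ∈ X →
        f j ≤ f j * ((if s j ∈ X then 1 else 0) + (if t j ∈ X then 1 else 0)) := by
      intro X hX
      refine le_mul_of_one_le_right hfj.le ?_
      rcases hX with h | h <;> simp only [h, if_true] <;> split_ifs <;> norm_num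
    have e3 : 0 ≤ ∑ X ∈ M,
        f j * ((if s j ∈ X \ W₀ then 1 else 0) + (if t j ∈ X \ W₀ then 1 else 0)) :=
      Finset.sum_nonneg fun X _ => e1 _
    have e4 := e1 W₀
    rcases hcover j hj with h | h | ⟨X, hXM, hX⟩
    · have := hf1 j hj
      simp only [h, if_true]
      linarith
    · have := e2 W₀ h
      linarith
    · have h1 := e2 (X \ W₀) (Or.inl hX)
      have h2 := Finset.single_le_sum (f := fun X : Finset V =>
        f j * ((if s j ∈ X \ W₀ then 1 else 0) + (if t j ∈ X \ W₀ then 1 else 0)))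
        (fun Y _ => e1 (Y \ W₀)) hXM
      linarith
  have hsum := Finset.sum_le_sum hbound
  rw [Finset.sum_add_distrib, Finset.sum_add_distrib, Finset.sum_comm] at hsum
  have g1 : ∑ j ∈ A, (if j ∈ I then (1 : ℝ) else 0) = I.card := by
    rw [← Finset.sum_filter, Finset.filter_mem_eq_inter, Finset.inter_eq_right.2 hIA]
    simp
  have g2 : load s t A f W₀ ≤ 2 * (I.card : ℝ) := by
    refine (hcut W₀ huW₀).trans ?_
    exact_mod_cast hW₀.trans (ends_le s t I W₀)
  have g3 : ∑ X ∈ M, load s t A f (X \ W₀) ≤ 6 * (I.card : ℝ) := by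
    refine (Finset.sum_le_sum fun X hX =>
      hcut (X \ W₀) (by simp [(hMF X hX).2.1])).trans ?_
    exact_mod_cast hloc
  simp only [load] at g2 g3
  linarith

omit [DecidableEq V] [Fintype V] in
lemma HasIntegralRouting.mono {c : ℕ} {N N' : ℝ} (h : HasIntegralRouting G s t c N)
    (hN : N' ≤ N) : HasIntegralRouting G s t c N' := by
  obtain ⟨I, Q, h1, h2⟩ := h
  exact ⟨I, Q, hN.trans h1, h2⟩

/-- **Routing through a single vertex**: demands of weight `f ≤ 1` whose terminals can
simultaneously send their weights to `u` have an integral edge-disjoint routing of a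
constant fraction of the total weight. -/
theorem hasIntegralRouting_through_vertex (hf : ∀ j, 0 ≤ f j) (hf1 : ∀ j, f j ≤ 1)
    (hcut : ∀ W, u ∉ W → load s t Finset.univ f W ≤ dcut (adjPairs G) W) :
    HasIntegralRouting G s t 1 ((∑ j, f j) / 12) := by
  classical
  set P := Finset.univ.filter fun j => 0 < f j with hP
  have hPsum : ∑ j ∈ P, f j = ∑ j, f j := by
    refine Finset.sum_filter_of_ne fun j _ hj => lt_of_le_of_ne (hf j) hj.symm
  have hfP : ∀ j ∈ P, 0 < f j := fun j hj => (Finset.mem_filter.1 hj).2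
  set bridge : Fin n → Prop := fun j =>
    ∃ W, u ∉ W ∧ s j ∈ W ∧ t j ∈ W ∧ dcut (adjPairs G) W ≤ 1 with hbridge
  have hcut' : ∀ A : Finset (Fin n), ∀ W, u ∉ W → load s t A f W ≤ dcut (adjPairs G) W :=
    fun A W hW => (load_mono (Finset.subset_univ A) (fun j _ => hf j) W).trans (hcut W hW)
  have hB := hasIntegralRouting_of_bridge_sets (G := G) (u := u) (s := s) (t := t) (f := f)
    (A := P.filter bridge) (fun j hj => hfP j (Finset.mem_filter.1 hj).1) (hcut' _)
    (fun j hj => (Finset.mem_filter.1 hj).2)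
  obtain ⟨I, hI, hIsum⟩ := exists_linked_of_no_bridge (G := G) (u := u) (s := s) (t := t)
    (f := f) (A := P.filter fun j => ¬ bridge j)
    (fun j hj => hfP j (Finset.mem_filter.1 hj).1) (fun j _ => hf1 j) (hcut' _) (by
      intro j hj W h1 h2 h3
      by_contra h4
      exact (Finset.mem_filter.1 hj).2 ⟨W, h1, h2, h3, by omega⟩)
  have hsplit := Finset.sum_filter_add_sum_filter_not P bridge f
  rw [hPsum] at hsplit
  have hI' := hasIntegralRouting_of_ends_le hI
  have hnn : 0 ≤ ∑ j, f j := Finset.sum_nonneg fun j _ => hf j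
  rcases le_total ((∑ j, f j) / 12) (∑ j ∈ P.filter bridge, f j) with h | h
  · exact hB.mono h
  · exact hI'.mono (by linarith)

end Demands

section Flows

variable {V : Type} [DecidableEq V] [Fintype V] {G : SimpleGraph V}

/-- A walk whose endpoints are separated by `W` uses an edge of the cut of `W`. -/
lemma one_le_sum_ecount_of_separated {a b : V} (P : G.Walk a b) {W : Finset V}
    (h : ¬ (a ∈ W ↔ b ∈ W)) :
    1 ≤ ∑ p ∈ (adjPairs G).filter (fun p => p.1 ∈ W ∧ p.2 ∉ W), ecount P.edges s(p.1, p.2) := by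
  have key : ∀ {a b : V} (P : G.Walk a b), a ∈ W → b ∉ W →
      ∃ p : V × V, p ∈ (adjPairs G).filter (fun p => p.1 ∈ W ∧ p.2 ∉ W) ∧
        s(p.1, p.2) ∈ P.edges := by
    intro a b P ha hb
    obtain ⟨d, hd, h1, h2⟩ := P.exists_boundary_dart (W : Set V) (by simpa) (by simpa)
    refine ⟨d.toProd, ?_, ?_⟩
    · simp only [Finset.mem_filter, mem_adjPairs]
      exact ⟨d.adj, by simpa using h1, by simpa using h2⟩
    · exact List.mem_map_of_mem hd
  have hex : ∃ p : V × V, p ∈ (adjPairs G).filter (fun p => p.1 ∈ W ∧ p.2 ∉ W) ∧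
      s(p.1, p.2) ∈ P.edges := by
    by_cases ha : a ∈ W
    · exact key P ha fun hb => h ⟨fun _ => hb, fun _ => ha⟩
    · obtain ⟨p, h1, h2⟩ := key P.reverse (by by_contra hb; tauto) ha
      exact ⟨p, h1, by simpa using h2⟩
  obtain ⟨p, hp, hpe⟩ := hex
  refine le_trans ?_ (Finset.single_le_sum (f := fun p : V × V => ecount P.edges s(p.1, p.2))
    (fun _ _ => Nat.zero_le _) hp)
  simp only [ecount_eq_count]
  exact List.count_pos_iff.2 hpe

/-- The total value of the flow walks whose endpoints are separated by `W` is at most the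
size of the cut. -/
lemma sum_separated_le_dcut {m : ℕ} {a b : Fin m → V} (P : ∀ i, G.Walk (a i) (b i))
    {w : Fin m → ℝ} (hw : ∀ i, 0 ≤ w i)
    (hcap : ∀ e : Sym2 V, ∑ i, (ecount (P i).edges e : ℝ) * w i ≤ 1) (W : Finset V) :
    (∑ i, if a i ∈ W ↔ b i ∈ W then 0 else w i) ≤ dcut (adjPairs G) W := by
  calc (∑ i, if a i ∈ W ↔ b i ∈ W then 0 else w i)
      ≤ ∑ i, ∑ p ∈ (adjPairs G).filter (fun p => p.1 ∈ W ∧ p.2 ∉ W),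
          (ecount (P i).edges s(p.1, p.2) : ℝ) * w i := by
        refine Finset.sum_le_sum fun i _ => ?_
        rw [← Finset.sum_mul]
        split_ifs with h
        · exact mul_nonneg (Finset.sum_nonneg fun _ _ => Nat.cast_nonneg _) (hw i)
        · refine le_mul_of_one_le_left (hw i) ?_
          exact_mod_cast one_le_sum_ecount_of_separated (P i) h
    _ = ∑ p ∈ (adjPairs G).filter (fun p => p.1 ∈ W ∧ p.2 ∉ W),
          ∑ i, (ecount (P i).edges s(p.1, p.2) : ℝ) * w i := Finset.sum_comm
    _ ≤ ∑ p ∈ (adjPairs G).filter (fun p => p.1 ∈ W ∧ p.2 ∉ W), 1 :=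
        Finset.sum_le_sum fun p _ => hcap _
    _ = dcut (adjPairs G) W := by simp [dcut]

end Flows

namespace FracSol

variable {V : Type} {G : SimpleGraph V} {n : ℕ} {s t : Fin n → V} (x : FracSol G s t)

lemma demVal_nonneg (j : Fin n) : 0 ≤ x.demVal j :=
  Finset.sum_nonneg fun i _ => by
    split_ifs
    exacts [x.nonneg i, le_rfl]

lemma demVal_le_vertexMarg (j : Fin n) : x.demVal j ≤ x.vertexMarg (s j) := by
  classical
  unfold vertexMarg
  refine le_trans (le_of_eq ?_) (Finset.single_le_sum
    (f := fun d => if s d = s j ∨ t d = s j then x.demVal d else 0) (fun d _ => ?_)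
    (Finset.mem_univ j))
  · simp
  · split_ifs
    exacts [x.demVal_nonneg d, le_rfl]

lemma sum_demVal_filter (p : Fin n → Prop) [DecidablePred p] :
    (∑ j, if p j then x.demVal j else 0) = ∑ i, if p (x.dem i) then x.xval i else 0 := by
  have h : ∀ j, (if p j then x.demVal j else 0)
      = ∑ i, if x.dem i = j then (if p j then x.xval i else 0) else 0 := by
    intro j
    unfold demVal
    split_ifs with hj <;> simp
  rw [Finset.sum_congr rfl fun j _ => h j, Finset.sum_comm]
  simp

lemma sum_demVal : ∑ j, x.demVal j = x.value := by
  simpa [value] using x.sum_demVal_filter fun _ => True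

lemma sum_demVal_separated_le [DecidableEq V] [Fintype V] (W : Finset V) :
    (∑ j, if s j ∈ W ↔ t j ∈ W then 0 else x.demVal j) ≤ dcut (adjPairs G) W := by
  have h := x.sum_demVal_filter fun j => ¬ (s j ∈ W ↔ t j ∈ W)
  simp only [ite_not] at h
  rw [h]
  exact sum_separated_le_dcut x.fpath x.nonneg x.capacity W

end FracSol

lemma min_sum_le_sum_min {ι : Type} (S : Finset ι) {c : ℝ} (hc : 0 ≤ c) {g : ι → ℝ}
    (hg : ∀ i ∈ S, 0 ≤ g i) : min c (∑ i ∈ S, g i) ≤ ∑ i ∈ S, min c (g i) := by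
  by_cases h : ∃ i ∈ S, c ≤ g i
  · obtain ⟨i, hi, hci⟩ := h
    refine (min_le_left _ _).trans (le_trans ?_ (Finset.single_le_sum
      (f := fun i => min c (g i)) (fun k hk => le_min hc (hg k hk)) hi))
    exact le_min le_rfl hci
  · push Not at h
    refine (min_le_right _ _).trans (Finset.sum_le_sum fun i hi => ?_)
    exact le_min (h i hi).le le_rfl


/-- **Routing through a small set with rerouting (Prop. `prop:withreroute`).** Let
`(G,H)` be a matching MEDP instance with feasible fractional solution `x`, and suppose
a second flow (respecting unit capacities) simultaneously routes at least `x_i/α` units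
from each terminal to a set `S ⊆ V`, where `α ≥ 1`. Then there is an integral routing,
on edge-disjoint paths, of at least `(1/(36·α·|S|))·Σᵢ xᵢ` of the demand pairs. -/
theorem medp_reroute_through_set
    (V : Type) [Fintype V] [DecidableEq V] (G : SimpleGraph V)
    (n : ℕ) (s t : Fin n → V) (hM : IsMatchingInstance s t)
    (x : FracSol G s t) (α : ℝ) (hα : 1 ≤ α) (S : Finset V)
    (hflow : RoutesToSet G (fun v => x.vertexMarg v / α) (terminalSet s t) S) :
    HasIntegralRouting G s t 1 (x.value / (36 * α * (S.card : ℝ))) := by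
  classical
  obtain ⟨m, a, b, P, g, hg, hab, hcap, hsup⟩ := hflow
  have hα0 : 0 < α := by linarith
  have hinj : Function.Injective s := by
    intro i j hij
    have := @hM (i, true) (j, true) (by simpa using hij)
    simpa using this
  rcases S.eq_empty_or_nonempty with rfl | hS
  · exact ⟨∅, fun d hd => absurd hd (Finset.notMem_empty d), by simp, by simp⟩
  have hS0 : (0 : ℝ) < S.card := by exact_mod_cast hS.card_pos
  set g' : Fin n → V → ℝ := fun j v => ∑ i, if a i = s j ∧ b i = v then g i else 0 with hg'
  have hg'0 : ∀ j v, 0 ≤ g' j v := fun j v => Finset.sum_nonneg fun i _ => by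
    split_ifs
    exacts [hg i, le_rfl]
  set c : Fin n → ℝ := fun j => x.demVal j / α with hc
  have hc0 : ∀ j, 0 ≤ c j := fun j => div_nonneg (x.demVal_nonneg j) hα0.le
  have hcx : ∀ j, c j ≤ x.demVal j := fun j => div_le_self (x.demVal_nonneg j) hα
  have hc1 : ∀ j, c j ≤ 1 := fun j => (hcx j).trans (x.perDemand j)
  have hg'c : ∀ j, c j ≤ ∑ v ∈ S, g' j v := by
    intro j
    have h1 := hsup (s j) (by simp [terminalSet])
    have h2 : c j ≤ x.vertexMarg (s j) / α :=
      div_le_div_of_nonneg_right (x.demVal_le_vertexMarg j) hα0.le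
    refine (h2.trans h1).trans (le_of_eq ?_)
    simp only [hg']
    rw [Finset.sum_comm]
    refine Finset.sum_congr rfl fun i _ => ?_
    by_cases h : a i = s j <;> simp [h, (hab i).2]
  set f : V → Fin n → ℝ := fun v j => min (c j) (g' j v) with hf
  have hf0 : ∀ v j, 0 ≤ f v j := fun v j => le_min (hc0 j) (hg'0 j v)
  have hsum : ∑ v ∈ S, x.value / α / S.card ≤ ∑ v ∈ S, ∑ j, f v j := by
    rw [Finset.sum_const, nsmul_eq_mul, mul_div_cancel₀ _ hS0.ne', Finset.sum_comm,
      ← x.sum_demVal, Finset.sum_div]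
    refine Finset.sum_le_sum fun j _ => ?_
    refine le_trans ?_ (min_sum_le_sum_min S (hc0 j) fun v _ => hg'0 j v)
    exact le_min le_rfl (hg'c j)
  obtain ⟨u, -, hu⟩ := Finset.exists_le_of_sum_le hS hsum
  have hroute := hasIntegralRouting_through_vertex (G := G) (u := u) (s := s) (t := t)
    (f := fun j => f u j / 3) (fun j => div_nonneg (hf0 u j) (by norm_num))
    (fun j => by
      have : f u j ≤ 1 := (min_le_left _ _).trans (hc1 j)
      linarith) (by
      intro W hW
      have h1 : (∑ j, if s j ∈ W then f u j else 0) ≤ dcut (adjPairs G) W := by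
        refine le_trans ?_ (sum_separated_le_dcut P hg hcap W)
        calc (∑ j, if s j ∈ W then f u j else 0)
            ≤ ∑ j, if s j ∈ W then g' j u else 0 := by
              refine Finset.sum_le_sum fun j _ => ?_
              split_ifs
              exacts [min_le_right _ _, le_rfl]
          _ = ∑ j, ∑ i, if s j ∈ W ∧ a i = s j ∧ b i = u then g i else 0 := by
              refine Finset.sum_congr rfl fun j _ => ?_
              by_cases h : s j ∈ W <;> simp [h, hg']
          _ = ∑ i, ∑ j, if s j ∈ W ∧ a i = s j ∧ b i = u then g i else 0 := Finset.sum_comm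
          _ ≤ ∑ i, if a i ∈ W ↔ b i ∈ W then 0 else g i := by
              refine Finset.sum_le_sum fun i _ => ?_
              rw [← Finset.sum_filter, Finset.sum_const, nsmul_eq_mul]
              by_cases hsep : a i ∈ W ↔ b i ∈ W
              · rw [if_pos hsep, Finset.filter_false_of_mem]
                · simp
                · rintro j - ⟨k1, k2, k3⟩
                  rw [k2, k3] at hsep
                  exact hW (hsep.1 k1)
              · rw [if_neg hsep]
                refine mul_le_of_le_one_left (hg i) ?_
                have : (Finset.univ.filter
                    fun j => s j ∈ W ∧ a i = s j ∧ b i = u).card ≤ 1 := by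
                  refine Finset.card_le_one.2 fun j hj k hk => ?_
                  simp only [Finset.mem_filter] at hj hk
                  exact hinj (hj.2.2.1.symm.trans hk.2.2.1)
                exact_mod_cast this
      have h2 := x.sum_demVal_separated_le W
      have h3 : load s t Finset.univ (fun j => f u j / 3) W
          ≤ (2 * (∑ j, if s j ∈ W then f u j else 0)
            + ∑ j, if s j ∈ W ↔ t j ∈ W then 0 else x.demVal j) / 3 := by
        rw [Finset.mul_sum, ← Finset.sum_add_distrib, Finset.sum_div]
        refine Finset.sum_le_sum fun j _ => ?_
        have k1 : f u j ≤ x.demVal j := (min_le_left _ _).trans (hcx j)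
        have k2 := hf0 u j
        by_cases hs : s j ∈ W <;> by_cases ht : t j ∈ W <;>
          simp only [hs, ht, if_true, if_false, iff_true, iff_false, not_true_eq_false] <;>
          linarith
      linarith)
  refine hroute.mono ?_
  rw [← Finset.sum_div]
  have h36 : x.value / (36 * α * S.card) = x.value / α / S.card / 3 / 12 := by
    field_simp
    ring
  rw [h36]
  gcongr
end
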